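/- arXiv:math/9911234 — 5 statements merged into one kernel-verified Lean document; each statement's English description precedes it below -/
import Mathlib

section
/- Let θ: R → Z be a finite injective homomorphism of affine commutative integral domains over an algebraically closed field k such that the induced field extension Frac(R) ⊆ Frac(Z) is separable. Then there exists a maximal ideal M of Z that is unramified over M ∩ R. -/
/-- `M Z_M = m Z_M` where `m = M ∩ R`: the maximal ideal `M` of `Z` is unramified over `R`. -/
def Ideal.IsUnramifiedOver {R Z : Type*} [CommRing R] [CommRing Z] [Algebra R Z]
    (M : Ideal Z) (hM : M.IsMaximal) : Prop :=
  letI := hM.isPrime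
  Ideal.map (algebraMap Z (Localization.AtPrime M)) M =
    Ideal.map (algebraMap Z (Localization.AtPrime M))
      (Ideal.map (algebraMap R Z) (M.comap (algebraMap R Z)))

/-- A domain `Z` over `R` whose fraction field is separable over that of `R` is unramified over `R`
at the generic point. -/
theorem Algebra.isUnramifiedAt_bot_of_isSeparable (R Z K L : Type*) [CommRing R]
    [CommRing Z] [IsDomain Z] [Field K] [Field L] [Algebra R Z] [Algebra R K] [Algebra Z L]
    [Algebra R L] [Algebra K L] [IsScalarTower R Z L] [IsScalarTower R K L]
    [IsFractionRing R K] [IsFractionRing Z L] [Algebra.IsSeparable K L] :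
    Algebra.IsUnramifiedAt R (⊥ : Ideal Z) := by
  have : Algebra.FormallyUnramified R K := .of_isLocalization (nonZeroDivisors R)
  have : Algebra.FormallyUnramified K L := .of_isSeparable K L
  have : Algebra.FormallyUnramified R L := .comp R K L
  have : IsLocalization (⊥ : Ideal Z).primeCompl L := by
    rw [Ideal.primeCompl_bot]
    infer_instance
  exact .of_equiv ((IsLocalization.algEquiv (⊥ : Ideal Z).primeCompl L
    (Localization.AtPrime (⊥ : Ideal Z))).restrictScalars R)

/-- Over a Jacobson domain, generically unramified implies unramified at some maximal ideal. -/
theorem Algebra.exists_isMaximal_isUnramifiedAt (R Z : Type*) [CommRing R] [CommRing Z]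
    [IsJacobsonRing Z] [Algebra R Z] [Algebra.EssFiniteType R Z]
    (p : Ideal Z) [p.IsPrime] [Algebra.IsUnramifiedAt R p] :
    ∃ (M : Ideal Z) (_ : M.IsMaximal), Algebra.IsUnramifiedAt R M := by
  obtain ⟨x, hx, hx'⟩ := nonempty_inter_closedPoints (Z := Algebra.unramifiedLocus R Z)
    ⟨⟨p, ‹_›⟩, ‹_›⟩ Algebra.isOpen_unramifiedLocus.isLocallyClosed
  exact ⟨x.asIdeal, (PrimeSpectrum.isClosed_singleton_iff_isMaximal x).mp hx', hx⟩

/-- A maximal ideal at which `Z` is unramified over `R` generates its localization from below. -/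
theorem Ideal.isUnramifiedOver_of_isUnramifiedAt {R Z : Type*} [CommRing R] [CommRing Z]
    [Algebra R Z] [Algebra.EssFiniteType R Z] (M : Ideal Z) (hM : M.IsMaximal)
    [Algebra.IsUnramifiedAt R M] : M.IsUnramifiedOver (R := R) hM := by
  let := Localization.AtPrime.algebraOfLiesOver (M.under R) M
  have h := ((Algebra.isUnramifiedAt_iff_map_eq R (M.under R) M).mp inferInstance).2
  unfold Ideal.IsUnramifiedOver
  rw [Localization.AtPrime.map_eq_maximalIdeal, Ideal.map_map, ← IsScalarTower.algebraMap_eq]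
  exact h.symm

/-- Let `θ : R → Z` be a finite injective homomorphism of affine commutative integral domains
over an algebraically closed field `k` such that the induced extension of fraction fields
`Frac(R) ⊆ Frac(Z)` is separable.  Then there is a maximal ideal `M` of `Z` which is
unramified over `M ∩ R`. -/
theorem stmt2 {k R Z : Type*} [Field k] [IsAlgClosed k]
    [CommRing R] [CommRing Z] [IsDomain R] [IsDomain Z]
    [Algebra k R] [Algebra k Z]
    [Algebra.FiniteType k R] [Algebra.FiniteType k Z]
    [Algebra R Z] [IsScalarTower k R Z]
    (hinj : Function.Injective (algebraMap R Z))
    [Module.Finite R Z]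
    [Algebra (FractionRing R) (FractionRing Z)]
    [Algebra R (FractionRing Z)]
    [IsScalarTower R (FractionRing R) (FractionRing Z)]
    [IsScalarTower R Z (FractionRing Z)]
    [Algebra.IsSeparable (FractionRing R) (FractionRing Z)] :
    ∃ (M : Ideal Z) (hM : M.IsMaximal), M.IsUnramifiedOver (R := R) hM := by
  have : IsJacobsonRing Z := isJacobsonRing_of_finiteType (A := k)
  -- The scalar towers in the statement refer to the canonical action of `R` on `FractionRing Z`.
  let : Algebra R (FractionRing Z) := OreLocalization.instAlgebra
  have : IsScalarTower R (FractionRing R) (FractionRing Z) := ‹_›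
  have := Algebra.isUnramifiedAt_bot_of_isSeparable R Z (FractionRing R) (FractionRing Z)
  obtain ⟨M, hM, _⟩ := Algebra.exists_isMaximal_isUnramifiedAt R Z ⊥
  exact ⟨M, hM, M.isUnramifiedOver_of_isUnramifiedAt hM⟩
end

section
/- Let T be a prime k-algebra that is a finite module over its center Z, with Z an affine domain over the algebraically closed field k. If V and V' are non-isomorphic simple T-modules such that the annihilator of V in Z lies in the Azumaya locus of T (i.e. ker(ζ_V)·T is a maximal ideal of T), then Ext^1_T(V, V') = 0. -/
/-- A `T`-linear endomorphism which kills the quotient of an extension and is nonzero on its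
simple kernel splits the extension. -/
theorem exists_section_of_endomorphism {T V V' E : Type*} [Ring T]
    [AddCommGroup V] [Module T V] [AddCommGroup V'] [Module T V'] [IsSimpleModule T V']
    [AddCommGroup E] [Module T E] (i : V' →ₗ[T] E) (p : E →ₗ[T] V)
    (hi : Function.Injective i) (hp : Function.Surjective p) (hexact : Function.Exact i p)
    (f : E →ₗ[T] E) (hpf : ∀ e, p (f e) = 0) (hf : ∃ w, f (i w) ≠ 0) :
    ∃ s : V →ₗ[T] E, p ∘ₗ s = LinearMap.id := by
  have hrange : ∀ e, f e ∈ LinearMap.range i := fun e => (hexact (f e)).1 (hpf e)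
  let g : E →ₗ[T] V' :=
    (LinearEquiv.ofInjective i hi).symm.toLinearMap ∘ₗ f.codRestrict (LinearMap.range i) hrange
  have hig : ∀ e, i (g e) = f e := fun e => by
    have h := (LinearEquiv.ofInjective i hi).apply_symm_apply ⟨f e, hrange e⟩
    exact congrArg Subtype.val h
  have hgi : g ∘ₗ i ≠ 0 := by
    rintro h
    obtain ⟨w, hw⟩ := hf
    apply hw
    rw [← hig, show g (i w) = 0 from LinearMap.congr_fun h w, map_zero]
  let u := LinearEquiv.ofBijective (g ∘ₗ i) (LinearMap.bijective_of_ne_zero hgi)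
  refine ((hexact.split_tfae hi hp).out 1 0 rfl rfl).1 ⟨u.symm.toLinearMap ∘ₗ g, ?_⟩
  ext w
  exact u.symm_apply_apply w

/-- If `V` is simple and finitely many elements of `V` have joint annihilator contained in the
annihilator of the simple module `V'`, then `V'` is isomorphic to `V`. -/
theorem nonempty_linearEquiv_of_annihilator_le {T V V' ι : Type*} [Ring T] [Finite ι]
    [AddCommGroup V] [Module T V] [AddCommGroup V'] [Module T V']
    [IsSimpleModule T V] [IsSimpleModule T V'] (v : ι → V)
    (h : ∀ t : T, (∀ j, t • v j = 0) → ∀ w : V', t • w = 0) :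
    Nonempty (V ≃ₗ[T] V') := by
  have := IsSimpleModule.nontrivial T V'
  obtain ⟨w, hw⟩ := exists_ne (0 : V')
  let φ : T →ₗ[T] (ι → V) := LinearMap.toSpanSingleton T (ι → V) v
  let ψ : T →ₗ[T] V' := LinearMap.toSpanSingleton T V' w
  have hker : LinearMap.ker φ ≤ LinearMap.ker ψ := fun t ht =>
    h t (fun j => congrFun (show t • v = 0 from ht) j) w
  let q : LinearMap.range φ →ₗ[T] V' :=
    (LinearMap.ker φ).liftQ ψ hker ∘ₗ φ.quotKerEquivRange.symm.toLinearMap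
  have hq : Function.Surjective q := by
    refine Function.Surjective.comp (g := (LinearMap.ker φ).liftQ ψ hker) ?_
      φ.quotKerEquivRange.symm.surjective
    intro x
    obtain ⟨t, rfl⟩ := IsSimpleModule.toSpanSingleton_surjective T hw x
    exact ⟨Submodule.Quotient.mk t, rfl⟩
  obtain ⟨s, hs⟩ := IsSemisimpleModule.lifting_property q hq LinearMap.id
  have hne : ∃ j, (LinearMap.proj j ∘ₗ (LinearMap.range φ).subtype ∘ₗ s : V' →ₗ[T] V) ≠ 0 := by
    by_contra! hzero
    apply hw
    have hsw : s w = 0 := Subtype.ext (funext fun j => LinearMap.congr_fun (hzero j) w)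
    rw [← LinearMap.id_apply (R := T) w, ← hs, LinearMap.comp_apply, hsw, map_zero]
  obtain ⟨j, hj⟩ := hne
  exact ⟨(LinearEquiv.ofBijective _ (LinearMap.bijective_of_ne_zero hj)).symm⟩

/-- Let `T` be a prime affine `k`-algebra (`k` algebraically closed) which is a finite module
over its center `Z`, an affine domain.  If `V`, `V'` are non-isomorphic simple `T`-modules such
that the annihilator of `V` in `Z` lies in the Azumaya locus (i.e. `ker(ζ_V)·T` is a maximal
two-sided ideal of `T`), then `Ext¹_T(V, V') = 0`, i.e. every extension of `V` by `V'` splits. -/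
theorem stmt4 {k Z T : Type*} [Field k] [IsAlgClosed k]
    [CommRing Z] [IsDomain Z] [Algebra k Z] [Algebra.FiniteType k Z]
    [Ring T] [Algebra k T] [Algebra.FiniteType k T]
    [Algebra Z T] [IsScalarTower k Z T]
    (hprime : ∀ a b : T, (∀ x : T, a * x * b = 0) → a = 0 ∨ b = 0)
    (hinj : Function.Injective (algebraMap Z T))
    (hcenter : ∀ t : T, t ∈ Set.center T ↔ ∃ z : Z, algebraMap Z T z = t)
    [Module.Finite Z T]
    (V V' : Type*) [AddCommGroup V] [Module T V] [AddCommGroup V'] [Module T V']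
    [Module Z V] [IsScalarTower Z T V]
    [IsSimpleModule T V] [IsSimpleModule T V']
    (hniso : IsEmpty (V ≃ₗ[T] V'))
    (hAz : IsCoatom (TwoSidedIdeal.span
      (algebraMap Z T '' ((Module.annihilator Z V : Ideal Z) : Set Z)))) :
    ∀ (E : Type*) [AddCommGroup E] [Module T E] (i : V' →ₗ[T] E) (p : E →ₗ[T] V),
      Function.Injective i → Function.Surjective p → Function.Exact i p →
        ∃ s : V →ₗ[T] E, p ∘ₗ s = LinearMap.id := by
  intro E _ _ i p hi hp hexact
  have hcomm : ∀ (z : Z) (t : T), algebraMap Z T z * t = t * algebraMap Z T z := Algebra.commutes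
  by_cases hkill : ∀ z ∈ Module.annihilator Z V, ∀ w : V', algebraMap Z T z • w = 0
  · exfalso
    have := IsSimpleModule.nontrivial T V
    have hmemV (t : T) :
        t ∈ TwoSidedIdeal.ker (Module.toAddMonoidEnd T V) ↔ ∀ x : V, t • x = 0 := by
      rw [TwoSidedIdeal.mem_ker]
      exact DFunLike.ext_iff
    have hmemV' (t : T) :
        t ∈ TwoSidedIdeal.ker (Module.toAddMonoidEnd T V') ↔ ∀ x : V', t • x = 0 := by
      rw [TwoSidedIdeal.mem_ker]
      exact DFunLike.ext_iff
    have hleV : TwoSidedIdeal.span (algebraMap Z T '' (Module.annihilator Z V : Set Z)) ≤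
        TwoSidedIdeal.ker (Module.toAddMonoidEnd T V) := by
      rw [TwoSidedIdeal.span_le]
      rintro _ ⟨z, hz, rfl⟩
      exact (hmemV _).2 fun x => by rw [algebraMap_smul, Module.mem_annihilator.1 hz]
    have hleV' : TwoSidedIdeal.span (algebraMap Z T '' (Module.annihilator Z V : Set Z)) ≤
        TwoSidedIdeal.ker (Module.toAddMonoidEnd T V') := by
      rw [TwoSidedIdeal.span_le]
      rintro _ ⟨z, hz, rfl⟩
      exact (hmemV' _).2 (hkill z hz)
    have hproper : TwoSidedIdeal.ker (Module.toAddMonoidEnd T V) ≠ ⊤ := by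
      intro htop
      obtain ⟨x, hx⟩ := exists_ne (0 : V)
      have hone : (1 : T) ∈ TwoSidedIdeal.ker (Module.toAddMonoidEnd T V) := htop ▸ trivial
      exact hx (by simpa using (hmemV 1).1 hone x)
    have heq := (hAz.le_iff.1 hleV).resolve_left hproper
    have : Module.Finite Z V := Module.Finite.trans T V
    obtain ⟨n, v, hv⟩ := Module.Finite.exists_fin (R := Z) (M := V)
    refine not_nonempty_iff.2 hniso (nonempty_linearEquiv_of_annihilator_le v fun t ht => ?_)
    refine (hmemV' t).1 (hleV' (heq ▸ (hmemV t).2 fun x => ?_))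
    have hx : x ∈ Submodule.span Z (Set.range v) := hv ▸ Submodule.mem_top
    induction hx using Submodule.span_induction with
    | mem y hy => obtain ⟨j, rfl⟩ := hy; exact ht j
    | zero => exact smul_zero t
    | add y y' _ _ hy hy' => rw [smul_add, hy, hy', add_zero]
    | smul z y _ hy =>
      rw [← algebraMap_smul T z y, smul_smul, ← hcomm, mul_smul, hy, smul_zero]
  · push Not at hkill
    obtain ⟨z, hz, w, hw⟩ := hkill
    let f : E →ₗ[T] E :=
      { toFun := fun e => algebraMap Z T z • e
        map_add' := smul_add _
        map_smul' := fun t e => by simp [smul_smul, hcomm] }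
    refine exists_section_of_endomorphism i p hi hp hexact f (fun e => ?_) ⟨w, ?_⟩
    · change p (algebraMap Z T z • e) = 0
      rw [map_smul, algebraMap_smul, Module.mem_annihilator.1 hz]
    · change algebraMap Z T z • i w ≠ 0
      rw [← map_smul]
      exact fun h => hw (hi (h.trans (map_zero i).symm))
end

section
/- Let T be a prime affine k-algebra, finite over its affine central domain Z, and let R ⊆ Z be an affine subalgebra over which Z is finite. Let M be a maximal ideal of Z lying in the Azumaya locus of T, m = M ∩ R, S = Z \ M, and T_M = S^{-1}T. If n is the PI degree of T, then there is a k-algebra isomorphism T_M / m T_M ≅ Mat_n(Z_M / m Z_M). -/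
open scoped TensorProduct

/-- `n` is the PI degree of the affine `k`-algebra `T` finite over its center: equivalently,
`n` is the maximum of the `k`-dimensions of the simple `T`-modules (this maximum is attained). -/
def IsPIDegree (k T : Type*) [Field k] [Ring T] [Algebra k T] (n : ℕ) : Prop :=
  IsGreatest {d : ℕ | ∃ (V : Type) (_ : AddCommGroup V) (_ : Module k V) (_ : Module T V)
    (_ : IsScalarTower k T V), IsSimpleModule T V ∧ Module.finrank k V = d} n

theorem Matrix.linearIndependent_of_map_eq_single {Z T F ι : Type*} [CommRing Z] [IsDomain Z]
    [Ring T] [Algebra Z T] [Module.IsTorsionFree Z T] [Ring F] [Nontrivial F]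
    [Fintype ι] [DecidableEq ι] (φ : T →+* Matrix ι ι F) (hφ : Function.Surjective φ)
    (t : ι × ι → T) (ht : ∀ p, φ (t p) = Matrix.single p.1 p.2 1) :
    LinearIndependent Z t := by
  rcases isEmpty_or_nonempty ι with hι | hι
  · exact linearIndependent_empty_type
  let o : ι := Classical.arbitrary ι
  choose lift hlift using hφ
  let e := (Fintype.equivFin (ι × ι)).symm
  set N := Fintype.card (ι × ι)
  have hN : N ≠ 0 := Fintype.card_ne_zero
  rw [← linearIndependent_equiv e]
  by_contra h
  let f : MultilinearMap Z (fun _ : Fin N ↦ T) T :=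
    (MultilinearMap.mkPiAlgebraFin Z N T).compLinearMap fun i ↦
      LinearMap.mulLeftRight Z (lift (Matrix.single o (e i).1 1), lift (Matrix.single (e i).2 o 1))
  have hf (v : Fin N → T) : φ (f v) = (List.ofFn fun i ↦ Matrix.single o (e i).1 1 * φ (v i) *
      Matrix.single (e i).2 o 1).prod := by
    simp [f, map_list_prod, List.map_ofFn, Function.comp_def, hlift]
  have h0 := (MultilinearMap.alternatization f).map_linearDependent _ h
  apply_fun φ at h0
  rw [MultilinearMap.alternatization_apply, map_sum, Finset.sum_eq_single 1, map_zero] at h0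
  · have hid : IsIdempotentElem (Matrix.single o o (1 : F)) := by simp [IsIdempotentElem]
    have h1 : φ (f (t ∘ e)) = Matrix.single o o 1 := by
      rw [hf, ← hid.pow_eq hN]
      simp [ht, List.ofFn_const]
    have h2 : Matrix.single o o (1 : F) = 0 := by
      rw [← h1, ← h0]
      simp
      rfl
    simpa using congr($h2 o o)
  · intro σ _ hσ
    obtain ⟨i, hi⟩ : ∃ i, σ i ≠ i := by
      by_contra! H
      exact hσ (Equiv.ext H)
    have h1 : φ (f ((t ∘ e) ∘ σ)) = 0 := by
      rw [hf]
      refine List.prod_eq_zero (List.mem_ofFn.2 ⟨i, ?_⟩)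
      have hne : e (σ i) ≠ e i := e.injective.ne hi
      by_cases h1 : (e i).1 = (e (σ i)).1
      · have h2 : (e (σ i)).2 ≠ (e i).2 := fun h2 ↦ hne (Prod.ext h1.symm h2)
        simp [ht, h1, h2]
      · simp [ht, h1]
    have h2 : φ (f.domDomCongr σ (t ∘ e)) = 0 := h1
    exact (map_zsmul φ _ _).trans (by rw [h2, smul_zero])
  · simp

theorem IsSimpleModule.exists_surjective_matrix {k T V : Type*} [Field k] [IsAlgClosed k] [Ring T]
    [Algebra k T] [AddCommGroup V] [Module k V] [Module T V] [IsScalarTower k T V]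
    [IsSimpleModule T V] [FiniteDimensional k V] :
    ∃ φ : T →+* Matrix (Fin (Module.finrank k V)) (Fin (Module.finrank k V)) k,
      Function.Surjective φ := by
  have hs := IsSimpleModule.algebraMap_end_bijective_of_isAlgClosed (A := T) (V := V) k
  have : Module.Finite (Module.End T V) V := Module.Finite.of_restrictScalars_finite k _ _
  have h := Module.Finite.toModuleEnd_moduleEnd_surjective (R := T) (M := V)
  let b := Module.finBasis k V
  refine ⟨((LinearMap.toMatrixAlgEquiv b).toAlgHom.comp (Algebra.lsmul k k V)).toRingHom,
    (LinearMap.toMatrixAlgEquiv b).surjective.comp fun f ↦ ?_⟩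
  let g : Module.End (Module.End T V) V :=
    { toFun := f
      map_add' := f.map_add
      map_smul' := fun c v ↦ by
        obtain ⟨c, rfl⟩ := hs.2 c
        simp }
  obtain ⟨r, hr⟩ := h g
  exact ⟨r, LinearMap.ext fun v ↦ congr($hr v)⟩

theorem IsSimpleModule.exists_finrank_eq_of_surjective_matrix {k T : Type*} [Field k] [Ring T]
    [Algebra k T] [Small.{0} k] {d : ℕ} [NeZero d] (φ : T →ₐ[k] Matrix (Fin d) (Fin d) k)
    (hφ : Function.Surjective φ) :
    ∃ (V : Type) (_ : AddCommGroup V) (_ : Module k V) (_ : Module T V)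
      (_ : IsScalarTower k T V), IsSimpleModule T V ∧ Module.finrank k V = d := by
  let : Module T (Fin d → k) := Module.compHom _ φ.toRingHom
  have hsmul (t : T) (w : Fin d → k) : t • w = (φ t).mulVec w := rfl
  have hW : IsSimpleModule T (Fin d → k) := by
    refine isSimpleModule_iff_toSpanSingleton_surjective.2 ⟨inferInstance, fun v hv w ↦ ?_⟩
    obtain ⟨j, hj⟩ := Function.ne_iff.1 hv
    obtain ⟨t, ht⟩ := hφ (Matrix.of fun i l ↦ if l = j then w i * (v j)⁻¹ else 0)
    refine ⟨t, ?_⟩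
    rw [LinearMap.toSpanSingleton_apply, hsmul, ht]
    ext i
    simp only [Pi.zero_apply] at hj
    simp [Matrix.mulVec, dotProduct, hj]
  refine ⟨Shrink.{0} (Fin d → k), inferInstance, inferInstance, inferInstance,
    ⟨fun c t v ↦ ?_⟩, .congr (Shrink.linearEquiv T (Fin d → k)), ?_⟩
  · apply (Shrink.linearEquiv T (Fin d → k)).injective
    have h (c : k) (v) : Shrink.linearEquiv T (Fin d → k) (c • v) =
      c • Shrink.linearEquiv T (Fin d → k) v := (Shrink.linearEquiv k (Fin d → k)).map_smul c v
    rw [map_smul, h, map_smul, hsmul, hsmul, map_smul, Matrix.smul_mulVec]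
  · rw [(Shrink.linearEquiv k (Fin d → k)).finrank_eq, Module.finrank_fin_fun]

theorem TwoSidedIdeal.isSimpleRing_quotient {T : Type*} [Ring T] {I : TwoSidedIdeal T}
    (hI : IsCoatom I) : IsSimpleRing I.ringCon.Quotient := by
  have : Nontrivial I.ringCon.Quotient := by
    rw [RingCon.nontrivial_quotient]
    exact fun h ↦ hI.1 (TwoSidedIdeal.ringCon_injective h)
  refine .of_eq_bot_or_eq_top fun J ↦ ?_
  have hle : I ≤ J.comap I.ringCon.mk' := fun x hx ↦ by
    rw [← ker_ringCon_mk' I, mem_ker] at hx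
    rw [mem_comap, hx]
    exact J.zero_mem
  rcases hI.le_iff.1 hle with h | h
  · right
    rw [← one_mem_iff, ← map_one I.ringCon.mk', ← mem_comap, h]
    trivial
  · left
    refine eq_bot_iff.2 fun x hx ↦ ?_
    obtain ⟨x, rfl⟩ := I.ringCon.mk'_surjective x
    rwa [← mem_comap, h, ← ker_ringCon_mk' I, mem_ker] at hx

theorem TwoSidedIdeal.mem_span_image_algebraMap_iff {Z T : Type*} [CommRing Z] [Ring T] [Algebra Z T]
    (I : Ideal Z) (t : T) : t ∈ TwoSidedIdeal.span (algebraMap Z T '' I) ↔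
      t ∈ (I • ⊤ : Submodule Z T) := by
  constructor
  · let J : TwoSidedIdeal T := .mk' (I • ⊤ : Submodule Z T) (ZeroMemClass.zero_mem _)
      (AddMemClass.add_mem · ·) (NegMemClass.neg_mem ·)
      (fun {x y} hy ↦ by
        induction hy using Submodule.smul_induction_on' with
        | smul r hr n hn => rw [mul_smul_comm]; exact Submodule.smul_mem_smul hr trivial
        | add a ha b hb h1 h2 => rw [mul_add]; exact AddMemClass.add_mem h1 h2)
      (fun {x y} hx ↦ by
        induction hx using Submodule.smul_induction_on' with
        | smul r hr n hn => rw [smul_mul_assoc]; exact Submodule.smul_mem_smul hr trivial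
        | add a ha b hb h1 h2 => rw [add_mul]; exact AddMemClass.add_mem h1 h2)
    have hJ (x) : x ∈ J ↔ x ∈ (I • ⊤ : Submodule Z T) := by
      simp [J, TwoSidedIdeal.mem_mk']
    rw [← hJ]
    refine fun h ↦ TwoSidedIdeal.span_le.2 ?_ h
    rintro _ ⟨r, hr, rfl⟩
    rw [SetLike.mem_coe, hJ, Algebra.algebraMap_eq_smul_one]
    exact Submodule.smul_mem_smul hr trivial
  · intro h
    induction h using Submodule.smul_induction_on' with
    | smul r hr n hn =>
      rw [Algebra.smul_def]
      exact TwoSidedIdeal.mul_mem_right _ _ _ (TwoSidedIdeal.subset_span ⟨r, hr, rfl⟩)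
    | add a ha b hb h1 h2 => exact AddMemClass.add_mem h1 h2

theorem Ideal.IsMaximal.exists_algHom_ker_eq {k Z : Type*} [Field k] [IsAlgClosed k] [CommRing Z]
    [Algebra k Z] [Algebra.FiniteType k Z] (M : Ideal Z) [M.IsMaximal] :
    ∃ κ : Z →ₐ[k] k, RingHom.ker κ = M := by
  let := Ideal.Quotient.field M
  have : Module.Finite k (Z ⧸ M) := finite_of_finite_type_of_isJacobsonRing k (Z ⧸ M)
  let e : k ≃ₐ[k] Z ⧸ M := .ofBijective (Algebra.ofId k _)
    (IsAlgClosed.algebraMap_bijective_of_isIntegral (k := k) (K := Z ⧸ M))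
  refine ⟨e.symm.toAlgHom.comp (Ideal.Quotient.mkₐ k M), Ideal.ext fun z ↦ ?_⟩
  simp [RingHom.mem_ker, Ideal.Quotient.eq_zero_iff_mem]

theorem exists_surjective_matrix_of_isCoatom_span {k Z T : Type*} [Field k] [IsAlgClosed k]
    [CommRing Z] [Algebra k Z] [Ring T] [Algebra k T] [Algebra Z T] [IsScalarTower k Z T]
    [Module.Finite Z T] (κ : Z →ₐ[k] k)
    (h : IsCoatom (TwoSidedIdeal.span (algebraMap Z T '' (RingHom.ker κ : Ideal Z)))) :
    ∃ (d : ℕ) (_ : NeZero d) (φ : T →ₐ[k] Matrix (Fin d) (Fin d) k), Function.Surjective φ ∧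
      (∀ (z : Z) (t : T), φ (z • t) = κ z • φ t) ∧
      ∀ t, φ t = 0 → t ∈ (RingHom.ker κ • ⊤ : Submodule Z T) := by
  set I := TwoSidedIdeal.span (algebraMap Z T '' (RingHom.ker κ : Ideal Z)) with hI
  have := TwoSidedIdeal.isSimpleRing_quotient h
  let π : T →ₐ[k] I.ringCon.Quotient := RingCon.mkₐ k I.ringCon
  have hπ : Function.Surjective π := I.ringCon.mk'_surjective
  have hker (t) : π t = 0 ↔ t ∈ (RingHom.ker κ • ⊤ : Submodule Z T) := by
    rw [← TwoSidedIdeal.mem_span_image_algebraMap_iff]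
    have h : t ∈ TwoSidedIdeal.ker I.ringCon.mk' ↔ t ∈ I := by rw [TwoSidedIdeal.ker_ringCon_mk']
    exact h
  have hsmul (z : Z) (t : T) : π (z • t) = κ z • π t := by
    rw [← map_smul, ← sub_eq_zero, ← map_sub, hker, ← algebraMap_smul Z (κ z), ← sub_smul]
    refine Submodule.smul_mem_smul ?_ trivial
    simp [RingHom.mem_ker]
  have : Module.Finite k I.ringCon.Quotient := by
    obtain ⟨s, hs⟩ := Module.Finite.fg_top (R := Z) (M := T)
    classical
    refine ⟨⟨s.image π, eq_top_iff.2 fun x _ ↦ ?_⟩⟩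
    obtain ⟨t, rfl⟩ := hπ x
    have ht : t ∈ Submodule.span Z (s : Set T) := hs ▸ trivial
    induction ht using Submodule.span_induction with
    | mem t ht => exact Submodule.subset_span (by simpa using ⟨t, ht, rfl⟩)
    | zero => rw [map_zero]; exact Submodule.zero_mem _
    | add a b _ _ h1 h2 => rw [map_add]; exact add_mem (h1 trivial) (h2 trivial)
    | smul z t _ h => rw [hsmul]; exact Submodule.smul_mem _ _ (h trivial)
  obtain ⟨d, hd, ⟨e⟩⟩ := IsSimpleRing.exists_algEquiv_matrix_of_isAlgClosed k I.ringCon.Quotient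
  refine ⟨d, hd, e.toAlgHom.comp π, e.surjective.comp hπ, fun z t ↦ ?_, fun t ht ↦ ?_⟩
  · simp [hsmul]
  · rw [← hker]
    exact e.injective (by simpa using ht)

theorem Submodule.mul_mem_smul_top {A B : Type*} [CommRing A] [Ring B] [Algebra A B]
    {I J : Ideal A} {x y : B} (hx : x ∈ (I • ⊤ : Submodule A B))
    (hy : y ∈ (J • ⊤ : Submodule A B)) : x * y ∈ ((I * J) • ⊤ : Submodule A B) := by
  induction hx using Submodule.smul_induction_on' with
  | smul r hr n hn =>
    induction hy using Submodule.smul_induction_on' with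
    | smul s hs m hm =>
      rw [smul_mul_smul_comm]
      exact Submodule.smul_mem_smul (Ideal.mul_mem_mul hr hs) trivial
    | add a ha b hb h1 h2 => rw [mul_add]; exact add_mem h1 h2
  | add a ha b hb h1 h2 => rw [add_mul]; exact add_mem h1 h2

theorem isNilpotent_of_mem_smul_top {A B : Type*} [CommRing A] [Ring B] [Algebra A B]
    {I : Ideal A} (hI : IsNilpotent I) {x : B} (hx : x ∈ (I • ⊤ : Submodule A B)) :
    IsNilpotent x := by
  obtain ⟨m, hm⟩ := hI
  have h (m : ℕ) : x ^ m ∈ (I ^ m • ⊤ : Submodule A B) := by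
    induction m with
    | zero => simp
    | succ m ih => exact pow_succ x m ▸ pow_succ I m ▸ Submodule.mul_mem_smul_top ih hx
  refine ⟨m, ?_⟩
  simpa [hm] using h m

open IsLocalRing in
theorem exists_ringEquiv_matrix_of_isNilpotent_maximalIdeal {A B k ι : Type*} [CommRing A]
    [IsLocalRing A] [Ring B] [Algebra A B] [Field k] [Algebra A k] [Fintype ι] [DecidableEq ι]
    [Nonempty ι] (hA : IsNilpotent (maximalIdeal A))
    (hk : Function.Surjective (algebraMap A k)) (b : Module.Basis (ι × ι) A B)
    (ψ : B →ₐ[A] Matrix ι ι k) (hψ : Function.Surjective ψ)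
    (hker : ∀ x, ψ x = 0 → x ∈ (maximalIdeal A • ⊤ : Submodule A B)) :
    Nonempty (B ≃+* Matrix ι ι A) := by
  have := Module.Finite.of_basis b
  have hsmul (a : A) (m : Matrix ι ι k) : a • m = algebraMap A k a • m :=
    algebra_compatible_smul k a m
  let o : ι := Classical.arbitrary ι
  obtain ⟨e, he, hψe⟩ := exists_isIdempotentElem_eq_of_ker_isNilpotent ψ.toRingHom
    (fun x hx ↦ isNilpotent_of_mem_smul_top hA (hker x hx)) (Matrix.single o o 1) (hψ _)
    (by simp [IsIdempotentElem])
  replace hψe : ψ e = Matrix.single o o 1 := hψe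
  have hcorner (x : B) : ∃ a : A, e * x * e = a • e := by
    let f := LinearMap.mulLeftRight A (e, e)
    have hf (x) : f x = e * x * e := by simp [f]
    have hle : LinearMap.range f ≤ A ∙ e := by
      refine Submodule.le_of_le_smul_of_le_jacobson_bot
        (by rw [LinearMap.range_eq_map]; exact Module.Finite.fg_top.map _)
        (maximalIdeal_le_jacobson _) ?_
      rintro _ ⟨x, rfl⟩
      obtain ⟨a, ha⟩ := hk (ψ x o o)
      have h1 : f x - a • e ∈ (maximalIdeal A • LinearMap.range f : Submodule A B) := by
        rw [LinearMap.range_eq_map, ← Submodule.map_smul'']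
        refine ⟨f x - a • e, hker _ ?_, ?_⟩
        · rw [hf, map_sub, map_mul, map_mul, map_smul, hψe, Matrix.single_mul_mul_single,
            ← ha, Matrix.smul_single, Algebra.algebraMap_eq_smul_one]
          simp
        · simp only [hf, mul_sub, sub_mul, mul_smul_comm, smul_mul_assoc, ← mul_assoc, he.eq]
          simp only [mul_assoc, he.eq]
      rw [← sub_add_cancel (f x) (a • e), add_comm]
      exact Submodule.add_mem_sup (Submodule.mem_span_singleton.2 ⟨a, rfl⟩) h1
    obtain ⟨a, ha⟩ := Submodule.mem_span_singleton.1 (hle ⟨x, rfl⟩)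
    exact ⟨a, by rw [ha, hf]⟩
  choose s hs using fun i ↦ hψ (Matrix.single i o 1)
  choose r hr using fun i ↦ hψ (Matrix.single o i 1)
  choose g hg using fun j i ↦ hcorner (r j * s i)
  replace hg (j i) : (e * r j) * (s i * e) = g j i • e := by rw [← hg]; simp only [mul_assoc]
  let g : Matrix ι ι A := Matrix.of g
  replace hg (j i) : (e * r j) * (s i * e) = g j i • e := hg j i
  have hg1 : g.map (algebraMap A k) = 1 := by
    ext j i
    have := congr($(congr(ψ $(hg j i))) o o)
    simp only [map_mul, hs, hr, hψe, map_smul] at this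
    rw [Matrix.map_apply, Algebra.algebraMap_eq_smul_one, Matrix.one_apply]
    by_cases h : j = i
    · subst h
      simpa using this.symm
    · simpa [h] using this.symm
  have hgu : IsUnit g.det := by
    have hmax : RingHom.ker (algebraMap A k) = maximalIdeal A :=
      eq_maximalIdeal (RingHom.ker_isMaximal_of_surjective _ hk)
    by_contra h
    rw [← mem_nonunits_iff, ← mem_maximalIdeal, ← hmax, RingHom.mem_ker, RingHom.map_det,
      RingHom.mapMatrix_apply, hg1, Matrix.det_one] at h
    exact one_ne_zero h
  have hg2 : g⁻¹.map (algebraMap A k) = 1 := by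
    have := congr((algebraMap A k).mapMatrix $(Matrix.nonsing_inv_mul g hgu))
    simpa [hg1] using this
  let q (j : ι) : B := ∑ l, g⁻¹ j l • (e * r l)
  have hq (j i) : q j * (s i * e) = if j = i then e else 0 := by
    have := congr($(Matrix.nonsing_inv_mul g hgu) j i)
    simp only [q, Finset.sum_mul, smul_mul_assoc, hg, smul_smul, ← Finset.sum_smul]
    rw [← Matrix.mul_apply, this, Matrix.one_apply]
    split_ifs <;> simp
  have heq (j) : e * q j = q j := by
    simp only [q, Finset.mul_sum, mul_smul_comm, ← mul_assoc, he.eq]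
  have hψq (j) : ψ (q j) = Matrix.single o j 1 := by
    have h (l) : algebraMap A k (g⁻¹ j l) = (1 : Matrix ι ι k) j l := congr($hg2 j l)
    simp only [q, map_sum, map_smul, map_mul, hψe, hr, hsmul, h,
      Matrix.one_apply]
    simp
  let f : Matrix ι ι A →ₗ[A] B :=
    { toFun a := ∑ i, ∑ j, a i j • (s i * e * q j)
      map_add' := by simp [add_smul, Finset.sum_add_distrib]
      map_smul' := by simp [mul_smul, Finset.smul_sum] }
  have hf (a) : f a = ∑ i, ∑ j, a i j • (s i * e * q j) := rfl
  have hmul (x y) : f (x * y) = f x * f y := by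
    have h (i j i' j') : s i * e * q j * (s i' * e * q j') =
        if j = i' then s i * e * q j' else 0 := by
      rw [show s i * e * q j * (s i' * e * q j') = s i * e * (q j * (s i' * e)) * q j' by
        simp only [mul_assoc], hq]
      split_ifs
      · simp only [mul_assoc, heq]
      · simp
    have h' (i j) : s i * e * q j * f y = ∑ j', y j j' • (s i * e * q j') := by
      simp only [hf, Finset.mul_sum, mul_smul_comm, h]
      rw [Finset.sum_eq_single j] <;> simp +contextual [eq_comm]
    rw [hf x, Finset.sum_mul, hf]
    refine Finset.sum_congr rfl fun i _ ↦ ?_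
    simp only [Finset.sum_mul, smul_mul_assoc, h', Matrix.mul_apply, Finset.sum_smul,
      Finset.smul_sum, smul_smul]
    exact Finset.sum_comm
  have hsurj : Function.Surjective f := by
    rw [← LinearMap.range_eq_top, eq_top_iff]
    refine Submodule.le_of_le_smul_of_le_jacobson_bot Module.Finite.fg_top
        (maximalIdeal_le_jacobson _) fun x _ ↦ ?_
    choose a ha using fun i j ↦ hk (ψ x i j)
    rw [← add_sub_cancel (f (Matrix.of a)) x]
    refine Submodule.add_mem_sup ⟨_, rfl⟩ (hker _ ?_)
    rw [map_sub, sub_eq_zero, hf]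
    simp only [map_sum, map_smul, map_mul, hψe, hψq, hs, hsmul,
      Matrix.of_apply, ha]
    simpa using (ψ x).matrix_eq_sum_single
  have hinj : Function.Injective f := by
    let u := b.equiv (Matrix.stdBasis A ι ι) (Equiv.refl _)
    have := OrzechProperty.injective_of_surjective_endomorphism (f ∘ₗ u.toLinearMap)
      (hsurj.comp u.surjective)
    exact (u.toEquiv.injective_comp f).1 this
  exact ⟨.symm { LinearEquiv.ofBijective f ⟨hinj, hsurj⟩ with map_mul' := hmul }⟩

open IsLocalRing in
theorem isNilpotent_maximalIdeal_quotient {R Z L : Type*} [CommRing R] [CommRing Z] [Algebra R Z]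
    [Algebra.IsIntegral R Z] [IsNoetherianRing Z] (M : Ideal Z) [M.IsMaximal] [CommRing L]
    [IsLocalRing L] [Algebra Z L] [IsLocalization.AtPrime L M] (I : Ideal L) [IsLocalRing (L ⧸ I)]
    (hI : Ideal.map (algebraMap Z L) (Ideal.map (algebraMap R Z) (M.comap (algebraMap R Z))) ≤ I) :
    IsNilpotent (maximalIdeal (L ⧸ I)) := by
  have : IsNoetherianRing L := IsLocalization.isNoetherianRing M.primeCompl L inferInstance
  rw [Ideal.FG.isNilpotent_iff_le_nilradical (IsNoetherian.noetherian _), nilradical_eq_sInf]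
  refine le_sInf fun P (hP : P.IsPrime) ↦ ?_
  have hp : ((P.comap (Ideal.Quotient.mk I)).comap (algebraMap Z L)).IsPrime := inferInstance
  set p := (P.comap (Ideal.Quotient.mk I)).comap (algebraMap Z L) with hpdef
  have hIP : I ≤ P.comap (Ideal.Quotient.mk I) := fun x hx ↦ by
    rw [Ideal.mem_comap, Ideal.Quotient.eq_zero_iff_mem.2 hx]
    exact P.zero_mem
  have hmax : (M.comap (algebraMap R Z)).IsMaximal := Ideal.isMaximal_comap_of_isIntegral_of_isMaximal M
  have hle : M.comap (algebraMap R Z) ≤ p.comap (algebraMap R Z) := by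
    rw [← Ideal.map_le_iff_le_comap, hpdef, ← Ideal.map_le_iff_le_comap]
    exact hI.trans hIP
  have hpmax : p.IsMaximal := by
    refine Ideal.isMaximal_of_isIntegral_of_isMaximal_comap (R := R) p ?_
    rwa [← hmax.eq_of_le (Ideal.IsPrime.ne_top inferInstance) hle]
  have hpM : p = M := by
    refine hpmax.eq_of_le (Ideal.IsPrime.ne_top inferInstance) ?_
    rw [← IsLocalization.AtPrime.under_maximalIdeal L M]
    exact Ideal.comap_mono (le_maximalIdeal (Ideal.IsPrime.ne_top inferInstance))
  intro x hx
  obtain ⟨y, rfl⟩ := Ideal.Quotient.mk_surjective x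
  have hy : y ∈ maximalIdeal L := fun h ↦ hx (h.map _)
  rw [← IsLocalization.AtPrime.map_eq_maximalIdeal M, ← hpM] at hy
  exact (Ideal.map_le_iff_le_comap (f := algebraMap Z L)).2 le_rfl hy

open IsLocalRing in
theorem Algebra.TensorProduct.exists_lift_matrix {Z A T k ι : Type*} [CommRing Z] [CommRing A]
    [IsLocalRing A] [Ring T] [Field k] [Algebra Z A] [Algebra Z T] [Algebra Z k] [Algebra A k]
    [IsScalarTower Z A k] [Fintype ι] [DecidableEq ι]
    (hk : Function.Surjective (algebraMap Z k)) (φ : T →ₐ[Z] Matrix ι ι k)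
    (hφ : ∀ t, φ t = 0 → t ∈ (RingHom.ker (algebraMap Z k) • ⊤ : Submodule Z T)) :
    ∃ ψ : A ⊗[Z] T →ₐ[A] Matrix ι ι k, (∀ t, ψ (1 ⊗ₜ t) = φ t) ∧
      ∀ x, ψ x = 0 → x ∈ (maximalIdeal A • ⊤ : Submodule A (A ⊗[Z] T)) := by
  have hmax : RingHom.ker (algebraMap A k) = maximalIdeal A :=
    eq_maximalIdeal (RingHom.ker_isMaximal_of_surjective _ fun c ↦ by
      obtain ⟨z, rfl⟩ := hk c
      exact ⟨algebraMap Z A z, (IsScalarTower.algebraMap_apply Z A k z).symm⟩)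
  let ψ : A ⊗[Z] T →ₐ[A] Matrix ι ι k :=
    Algebra.TensorProduct.lift (Algebra.ofId A _) φ fun a t ↦ Algebra.commutes a (φ t)
  have hψ (t) : ψ (1 ⊗ₜ t) = φ t :=
    (Algebra.TensorProduct.lift_tmul ..).trans (by simp)
  refine ⟨ψ, hψ, fun x hx ↦ ?_⟩
  have hM : ∀ t ∈ (RingHom.ker (algebraMap Z k) • ⊤ : Submodule Z T),
      (1 : A) ⊗ₜ[Z] t ∈ (maximalIdeal A • ⊤ : Submodule A (A ⊗[Z] T)) := fun t ht ↦ by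
    induction ht using Submodule.smul_induction_on' with
    | smul z hz t _ =>
      rw [TensorProduct.tmul_smul, ← algebraMap_smul A z]
      refine Submodule.smul_mem_smul ?_ trivial
      rwa [← hmax, RingHom.mem_ker, ← IsScalarTower.algebraMap_apply]
    | add a _ b _ h1 h2 => rw [TensorProduct.tmul_add]; exact add_mem h1 h2
  obtain ⟨t, ht⟩ : ∃ t : T, x - 1 ⊗ₜ t ∈ (maximalIdeal A • ⊤ : Submodule A (A ⊗[Z] T)) := by
    clear hx
    induction x using TensorProduct.induction_on with
    | zero => exact ⟨0, by simp⟩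
    | tmul a t =>
      obtain ⟨z, hz⟩ := hk (algebraMap A k a)
      refine ⟨z • t, ?_⟩
      have : a ⊗ₜ[Z] t - 1 ⊗ₜ (z • t) = (a - algebraMap Z A z) • (1 : A) ⊗ₜ[Z] t := by
        rw [sub_smul, algebraMap_smul, TensorProduct.tmul_smul, TensorProduct.smul_tmul' a,
          smul_eq_mul, mul_one]
      rw [this]
      refine Submodule.smul_mem_smul ?_ trivial
      rw [← hmax, RingHom.mem_ker, map_sub, ← IsScalarTower.algebraMap_apply, hz, sub_self]
    | add x y h1 h2 =>
      obtain ⟨t, ht⟩ := h1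
      obtain ⟨u, hu⟩ := h2
      exact ⟨t + u, by rw [TensorProduct.tmul_add, add_sub_add_comm]; exact add_mem ht hu⟩
  have hzero : ∀ y ∈ (maximalIdeal A • ⊤ : Submodule A (A ⊗[Z] T)), ψ y = 0 := fun y hy ↦ by
    induction hy using Submodule.smul_induction_on' with
    | smul a ha y _ =>
      rw [← hmax, RingHom.mem_ker] at ha
      rw [map_smul, ← algebraMap_smul k, ha, zero_smul]
    | add a _ b _ h1 h2 => rw [map_add, h1, h2, add_zero]
  have h0 := hzero _ ht
  rw [map_sub, hx, zero_sub, neg_eq_zero, hψ] at h0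
  rw [← sub_add_cancel x (1 ⊗ₜ t)]
  exact add_mem ht (hM t (hφ t h0))

open IsLocalRing in
theorem exists_basis_tensorProduct_of_map_eq_single {Z L T k ι : Type*} [CommRing Z] [IsDomain Z]
    [CommRing L] [IsLocalRing L] [Algebra Z L] (S : Submonoid Z) [IsLocalization S L] [Ring T]
    [Algebra Z T] [Module.Finite Z T] [Module.IsTorsionFree Z T] [Field k] [Algebra Z k]
    [Algebra L k] [IsScalarTower Z L k] [Fintype ι] [DecidableEq ι]
    (hk : Function.Surjective (algebraMap Z k)) (φ : T →ₐ[Z] Matrix ι ι k)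
    (hφ : ∀ t, φ t = 0 → t ∈ (RingHom.ker (algebraMap Z k) • ⊤ : Submodule Z T))
    (t : ι × ι → T) (ht : ∀ p, φ (t p) = Matrix.single p.1 p.2 1) (hli : LinearIndependent Z t) :
    ∃ b : Module.Basis (ι × ι) L (L ⊗[Z] T), ∀ p, b p = 1 ⊗ₜ t p := by
  have hli : LinearIndependent L fun p ↦ (1 : L) ⊗ₜ[Z] t p :=
    hli.of_isLocalizedModule L S (TensorProduct.mk Z L T 1)
  refine ⟨.mk hli ?_, fun p ↦ Module.Basis.mk_apply ..⟩
  obtain ⟨ψ, hψ, hker⟩ := Algebra.TensorProduct.exists_lift_matrix (A := L) hk φ hφ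
  refine Submodule.le_of_le_smul_of_le_jacobson_bot Module.Finite.fg_top
    (maximalIdeal_le_jacobson _) fun x _ ↦ ?_
  choose a ha using fun i j ↦ hk (ψ x i j)
  rw [← add_sub_cancel (∑ i, ∑ j, algebraMap Z L (a i j) • (1 : L) ⊗ₜ[Z] t (i, j)) x]
  refine Submodule.add_mem_sup (sum_mem fun i _ ↦ sum_mem fun j _ ↦ Submodule.smul_mem _ _
    (Submodule.subset_span ⟨(i, j), rfl⟩)) (hker _ ?_)
  have hsmul (c : L) (m : Matrix ι ι k) : c • m = algebraMap L k c • m :=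
    algebra_compatible_smul k c m
  simp only [map_sub, sub_eq_zero, map_sum, map_smul, hψ, ht, hsmul,
    ← IsScalarTower.algebraMap_apply, ha]
  simpa using (ψ x).matrix_eq_sum_single

theorem TwoSidedIdeal.nonempty_ringEquiv_quotient {B C : Type*} [Ring B] [Ring C]
    (J : TwoSidedIdeal B) (f : B →+* C) (hf : Function.Surjective f)
    (h : ∀ x, x ∈ J ↔ f x = 0) : Nonempty (J.ringCon.Quotient ≃+* C) := by
  have hJ : J.ringCon = RingCon.ker f := RingCon.ext fun x y ↦ by
    rw [J.rel_iff, h, map_sub, sub_eq_zero]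
    rfl
  exact ⟨.ofBijective (J.ringCon.lift f hJ.le) (RingCon.lift_bijective_iff.2 ⟨hJ, hf⟩)⟩

open IsLocalRing in
theorem nonempty_ringEquiv_matrix_quotient {Z L T k ι : Type*} [CommRing Z] [CommRing L]
    [Algebra Z L] [Ring T] [Algebra Z T] [Field k] [Algebra Z k] [Fintype ι] [DecidableEq ι]
    [Nonempty ι] (I : Ideal L) [IsLocalRing (L ⧸ I)] [Algebra (L ⧸ I) k] [IsScalarTower Z (L ⧸ I) k]
    (hI : IsNilpotent (maximalIdeal (L ⧸ I)))
    (hk : Function.Surjective (algebraMap Z k)) (φ : T →ₐ[Z] Matrix ι ι k)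
    (hφ' : Function.Surjective φ)
    (hφ : ∀ t, φ t = 0 → t ∈ (RingHom.ker (algebraMap Z k) • ⊤ : Submodule Z T))
    (t : ι × ι → T) (b : Module.Basis (ι × ι) L (L ⊗[Z] T)) (hb : ∀ p, b p = 1 ⊗ₜ t p)
    (J : TwoSidedIdeal (L ⊗[Z] T)) (hJ : ∀ x, x ∈ J ↔ x ∈ (I • ⊤ : Submodule L (L ⊗[Z] T))) :
    Nonempty (J.ringCon.Quotient ≃+* Matrix ι ι (L ⧸ I)) := by
  obtain ⟨ψ, hψ, hker⟩ := Algebra.TensorProduct.exists_lift_matrix (A := L ⧸ I) hk φ hφ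
  let b' : Module.Basis (ι × ι) (L ⧸ I) ((L ⧸ I) ⊗[Z] T) :=
    (Algebra.TensorProduct.basis (L ⧸ I) b).map
      (TensorProduct.AlgebraTensorModule.cancelBaseChange Z L (L ⧸ I) (L ⧸ I) T)
  have hb' (p) : b' p = 1 ⊗ₜ t p := by
    simp [b', hb]
  obtain ⟨e⟩ := exists_ringEquiv_matrix_of_isNilpotent_maximalIdeal hI
    (fun c ↦ by
      obtain ⟨z, rfl⟩ := hk c
      exact ⟨algebraMap Z (L ⧸ I) z, (IsScalarTower.algebraMap_apply ..).symm⟩) b' ψ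
    (fun m ↦ by
      obtain ⟨t, rfl⟩ := hφ' m
      exact ⟨_, hψ t⟩) hker
  let f : L ⊗[Z] T →ₐ[Z] (L ⧸ I) ⊗[Z] T :=
    Algebra.TensorProduct.map (IsScalarTower.toAlgHom Z L (L ⧸ I)) (AlgHom.id Z T)
  have hf (l : L) (x : L ⊗[Z] T) : f (l • x) = Ideal.Quotient.mk I l • f x := by
    induction x using TensorProduct.induction_on with
    | zero => simp
    | tmul a t => simp [f, TensorProduct.smul_tmul']
    | add x y h1 h2 => rw [smul_add, map_add, h1, h2, map_add, smul_add]
  have hfb (p) : f (b p) = b' p := by simp [f, hb, hb']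
  have hfsurj : Function.Surjective f :=
    TensorProduct.map_surjective Ideal.Quotient.mk_surjective Function.surjective_id
  obtain ⟨e'⟩ := J.nonempty_ringEquiv_quotient f.toRingHom hfsurj fun x ↦ by
    change x ∈ J ↔ f x = 0
    rw [hJ]
    refine ⟨fun hx ↦ ?_, fun hx ↦ ?_⟩
    · induction hx using Submodule.smul_induction_on' with
      | smul l hl y _ => rw [hf, Ideal.Quotient.eq_zero_iff_mem.2 hl, zero_smul]
      | add a _ b _ h1 h2 => rw [map_add, h1, h2, add_zero]
    · rw [← b.sum_repr x] at hx ⊢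
      simp only [map_sum, hf, hfb] at hx
      have h0 := Fintype.linearIndependent_iff.1 b'.linearIndependent _ hx
      exact sum_mem fun p _ ↦
        Submodule.smul_mem_smul (Ideal.Quotient.eq_zero_iff_mem.1 (h0 p)) trivial
  exact ⟨e'.trans e⟩

theorem IsPIDegree.eq_of_basis {k Z L T : Type*} [Field k] [IsAlgClosed k] [CommRing Z]
    [IsDomain Z] [Ring T] [Algebra k T] [Algebra Z T] [Module.IsTorsionFree Z T] {n d : ℕ}
    [NeZero d] (hn : IsPIDegree k T n) (φ : T →ₐ[k] Matrix (Fin d) (Fin d) k)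
    (hφ : Function.Surjective φ) (S : Submonoid Z) [CommRing L] [Nontrivial L] [Algebra Z L]
    [IsLocalization S L] (b : Module.Basis (Fin d × Fin d) L (L ⊗[Z] T)) : n = d := by
  obtain ⟨V, _, _, _, _, hV, rfl⟩ := hn.1
  refine le_antisymm ?_ ?_
  · rcases (Module.finrank k V).eq_zero_or_pos with h0 | hpos
    · exact h0.trans_le (Nat.zero_le d)
    have : FiniteDimensional k V := Module.finite_of_finrank_pos hpos
    obtain ⟨χ, hχ⟩ := IsSimpleModule.exists_surjective_matrix (k := k) (T := T) (V := V)
    choose t ht using fun p : Fin _ × Fin _ ↦ hχ (Matrix.single p.1 p.2 1)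
    have hli : LinearIndependent L (TensorProduct.mk Z L T 1 ∘ t) :=
      (Matrix.linearIndependent_of_map_eq_single χ hχ t ht).of_isLocalizedModule L S
        (TensorProduct.mk Z L T 1)
    have := Module.Finite.of_basis b
    have := hli.fintype_card_le_finrank
    rw [Module.finrank_eq_card_basis b] at this
    simp only [Fintype.card_prod, Fintype.card_fin] at this
    exact Nat.mul_self_le_mul_self_iff.1 this
  · have := hV.nontrivial
    obtain ⟨v, hv⟩ := exists_ne (0 : V)
    have : Small.{0} k := small_of_injective (smul_left_injective k hv)
    exact hn.2 (IsSimpleModule.exists_finrank_eq_of_surjective_matrix φ hφ)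

theorem Module.IsTorsionFree.of_forall_mul_mul_eq_zero {Z T : Type*} [CommRing Z] [IsDomain Z]
    [Ring T] [Algebra Z T] (hprime : ∀ a b : T, (∀ x : T, a * x * b = 0) → a = 0 ∨ b = 0)
    (hinj : Function.Injective (algebraMap Z T)) : Module.IsTorsionFree Z T := by
  refine .of_smul_eq_zero fun z t h ↦ ?_
  refine (hprime (algebraMap Z T z) t fun x ↦ ?_).imp_left
    fun h ↦ hinj (h.trans (map_zero _).symm)
  rw [Algebra.commutes z x, mul_assoc, ← Algebra.smul_def, h, mul_zero]

theorem TwoSidedIdeal.span_image_algebraMap_map {Z L B : Type*} [CommRing Z] [CommRing L]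
    [Algebra Z L] [Ring B] [Algebra Z B] [Algebra L B] [IsScalarTower Z L B] (I : Ideal Z) :
    TwoSidedIdeal.span (algebraMap L B '' (I.map (algebraMap Z L) : Ideal L)) =
      TwoSidedIdeal.span (algebraMap Z B '' I) := by
  refine le_antisymm (TwoSidedIdeal.span_le.2 ?_) (TwoSidedIdeal.span_mono ?_)
  · rintro _ ⟨l, hl, rfl⟩
    have : l ∈ (TwoSidedIdeal.asIdeal (TwoSidedIdeal.span (algebraMap Z B '' I))).comap
        (algebraMap L B) := by
      refine (Ideal.map_le_iff_le_comap (f := algebraMap Z L)).2 (fun z hz ↦ ?_) hl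
      rw [Ideal.mem_comap, Ideal.mem_comap, TwoSidedIdeal.mem_asIdeal,
        ← IsScalarTower.algebraMap_apply]
      exact TwoSidedIdeal.subset_span ⟨z, hz, rfl⟩
    simpa using this
  · rintro _ ⟨z, hz, rfl⟩
    exact ⟨algebraMap Z L z, Ideal.mem_map_of_mem _ hz, (IsScalarTower.algebraMap_apply ..).symm⟩

/-- Let `T` be a prime affine `k`-algebra, finite over its affine central domain `Z`, and
`R ⊆ Z` an affine subalgebra over which `Z` is finite.  Let `M` be a maximal ideal of `Z`
lying in the Azumaya locus of `T` (i.e. `MT` is a maximal two-sided ideal of `T`), and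
`m = M ∩ R`.  If `n` is the PI degree of `T`, then there is an isomorphism
`T_M / m T_M ≅ Mat_n(Z_M / m Z_M)`, where `T_M = (Z \ M)⁻¹ T ≅ Z_M ⊗_Z T`. -/
theorem stmt5 {k R Z T : Type*} [Field k] [IsAlgClosed k]
    [CommRing R] [Algebra k R] [Algebra.FiniteType k R]
    [CommRing Z] [IsDomain Z] [Algebra k Z] [Algebra.FiniteType k Z]
    [Ring T] [Algebra k T] [Algebra.FiniteType k T]
    [Algebra Z T] [IsScalarTower k Z T]
    [Algebra R Z] [IsScalarTower k R Z]
    (hprime : ∀ a b : T, (∀ x : T, a * x * b = 0) → a = 0 ∨ b = 0)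
    (hinjZT : Function.Injective (algebraMap Z T))
    (hcenter : ∀ t : T, t ∈ Set.center T ↔ ∃ z : Z, algebraMap Z T z = t)
    [Module.Finite Z T]
    (hinjRZ : Function.Injective (algebraMap R Z))
    [Module.Finite R Z]
    (M : Ideal Z) [hM : M.IsMaximal]
    (hAz : IsCoatom (TwoSidedIdeal.span (algebraMap Z T '' (M : Set Z))))
    (n : ℕ) (hn : IsPIDegree k T n) :
    Nonempty ((TwoSidedIdeal.span ((algebraMap Z (Localization.AtPrime M ⊗[Z] T)) ''
        ((Ideal.map (algebraMap R Z) (M.comap (algebraMap R Z))) : Set Z))).ringCon.Quotient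
      ≃+* Matrix (Fin n) (Fin n)
        (Localization.AtPrime M ⧸ Ideal.map (algebraMap Z (Localization.AtPrime M))
          (Ideal.map (algebraMap R Z) (M.comap (algebraMap R Z))))) := by

  have : Module.IsTorsionFree Z T := .of_forall_mul_mul_eq_zero hprime hinjZT
  have : IsNoetherianRing Z := Algebra.FiniteType.isNoetherianRing k Z
  obtain ⟨κ, hκ⟩ := hM.exists_algHom_ker_eq (k := k)
  obtain ⟨d, _, φ, hφsurj, hφsmul, hφker⟩ :=
    exists_surjective_matrix_of_isCoatom_span κ (T := T) (by rwa [hκ])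
  let L := Localization.AtPrime M
  let I : Ideal L :=
    Ideal.map (algebraMap Z L) (Ideal.map (algebraMap R Z) (M.comap (algebraMap R Z)))
  let _ : Algebra Z k := κ.toRingHom.toAlgebra
  have hk : Function.Surjective (algebraMap Z k) := fun c ↦ ⟨algebraMap k Z c, κ.commutes c⟩
  let φZ : T →ₐ[Z] Matrix (Fin d) (Fin d) k :=
    AlgHom.ofLinearMap { φ with map_smul' := hφsmul } (map_one φ) (map_mul φ)
  have hunit (z : M.primeCompl) : IsUnit (algebraMap Z k z) :=
    IsUnit.mk0 _ fun h ↦ z.2 (hκ.le h)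
  let _ : Algebra L k := (IsLocalization.lift (M := M.primeCompl) (S := L) hunit).toAlgebra
  have : IsScalarTower Z L k :=
    .of_algebraMap_eq fun z ↦ (IsLocalization.lift_eq hunit z).symm
  have hIker : ∀ l ∈ I, algebraMap L k l = 0 := by
    refine fun l hl ↦ (?_ : I ≤ RingHom.ker (algebraMap L k)) hl
    rw [Ideal.map_le_iff_le_comap, Ideal.map_le_iff_le_comap]
    refine fun r hr ↦ ?_
    rw [Ideal.mem_comap, Ideal.mem_comap, RingHom.mem_ker, ← IsScalarTower.algebraMap_apply]
    rwa [Ideal.mem_comap, ← hκ] at hr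
  let _ : Algebra (L ⧸ I) k := (Ideal.Quotient.lift I (algebraMap L k) hIker).toAlgebra
  have : IsScalarTower Z (L ⧸ I) k :=
    .of_algebraMap_eq (S := L ⧸ I) fun z ↦ IsScalarTower.algebraMap_apply Z L k z
  have : Nontrivial (L ⧸ I) := (algebraMap (L ⧸ I) k).domain_nontrivial
  have : IsLocalRing (L ⧸ I) := .of_surjective' (Ideal.Quotient.mk I) Ideal.Quotient.mk_surjective
  choose t ht using fun p : Fin d × Fin d ↦ hφsurj (Matrix.single p.1 p.2 1)
  obtain ⟨b, hb⟩ := exists_basis_tensorProduct_of_map_eq_single (L := L) M.primeCompl hk φZ hφker t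
    ht (Matrix.linearIndependent_of_map_eq_single φ.toRingHom hφsurj t ht)
  obtain rfl := hn.eq_of_basis φ hφsurj M.primeCompl b
  refine nonempty_ringEquiv_matrix_quotient I (isNilpotent_maximalIdeal_quotient M I le_rfl) hk φZ
    hφsurj hφker t b hb _ fun x ↦ ?_
  rw [← TwoSidedIdeal.span_image_algebraMap_map (L := L),
    TwoSidedIdeal.mem_span_image_algebraMap_iff]
end

section
/- Let T be a prime affine k-algebra, finite over its affine central domain Z, and R ⊆ Z an affine subalgebra with Z finite over R. If M is a maximal ideal of Z lying in the Azumaya locus of T and m = M ∩ R, then the ramification index of M over m equals the Loewy length of the finite dimensional algebra T_M / m T_M. -/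
open scoped TensorProduct

section SmulTop

variable {Λ A : Type*} [CommRing Λ] [Ring A] [Algebra Λ A]

theorem mul_mem_mul_smul_top {I J : Ideal Λ} {a b : A} (ha : a ∈ I • (⊤ : Submodule Λ A))
    (hb : b ∈ J • (⊤ : Submodule Λ A)) : a * b ∈ (I * J) • (⊤ : Submodule Λ A) := by
  induction ha using Submodule.smul_induction_on' with
  | smul r hr x _ =>
    induction hb using Submodule.smul_induction_on' with
    | smul s hs y _ =>
      rw [smul_mul_smul_comm]
      exact Submodule.smul_mem_smul (Ideal.mul_mem_mul hr hs) trivial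
    | add y _ z _ hy hz => rw [mul_add]; exact add_mem hy hz
  | add x _ y _ hx hy => rw [add_mul]; exact add_mem hx hy

theorem mul_mem_smul_top_left {I : Ideal Λ} (a : A) {b : A}
    (hb : b ∈ I • (⊤ : Submodule Λ A)) : a * b ∈ I • (⊤ : Submodule Λ A) := by
  simpa using mul_mem_mul_smul_top (I := ⊤) (a := a) (by simp) hb

theorem mul_mem_smul_top_right {I : Ideal Λ} {a : A} (b : A)
    (ha : a ∈ I • (⊤ : Submodule Λ A)) : a * b ∈ I • (⊤ : Submodule Λ A) := by
  simpa using mul_mem_mul_smul_top (J := ⊤) (b := b) ha (by simp)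

theorem prod_ofFn_mem_pow_smul_top {I : Ideal Λ} {n : ℕ} (a : Fin n → A)
    (ha : ∀ i, a i ∈ I • (⊤ : Submodule Λ A)) :
    (List.ofFn a).prod ∈ I ^ n • (⊤ : Submodule Λ A) := by
  induction n with
  | zero => simp
  | succ n ih =>
    rw [List.ofFn_succ, List.prod_cons, pow_succ']
    exact mul_mem_mul_smul_top (ha 0) (ih _ fun i ↦ ha i.succ)

theorem algebraMap_mem_smul_top {I : Ideal Λ} {z : Λ} (hz : z ∈ I) :
    algebraMap Λ A z ∈ I • (⊤ : Submodule Λ A) := by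
  rw [Algebra.algebraMap_eq_smul_one]
  exact Submodule.smul_mem_smul hz trivial

theorem TwoSidedIdeal.mem_of_mem_smul_top {I : Ideal Λ} {J : TwoSidedIdeal A}
    (h : ∀ z ∈ I, algebraMap Λ A z ∈ J) {x : A} (hx : x ∈ I • (⊤ : Submodule Λ A)) : x ∈ J := by
  induction hx using Submodule.smul_induction_on' with
  | smul r hr x _ =>
    rw [Algebra.smul_def]
    exact J.mul_mem_right _ _ (h r hr)
  | add x _ y _ hx hy => exact J.add_mem hx hy

theorem TwoSidedIdeal.mem_span_algebraMap_image_iff {Z : Type*} [CommRing Z] [Algebra Z Λ]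
    [Algebra Z A] [IsScalarTower Z Λ A] {I : Ideal Z} {x : A} :
    x ∈ TwoSidedIdeal.span (algebraMap Z A '' (I : Set Z)) ↔
      x ∈ I.map (algebraMap Z Λ) • (⊤ : Submodule Λ A) := by
  constructor
  · intro hx
    induction hx using TwoSidedIdeal.span_induction with
    | mem x h =>
      obtain ⟨z, hz, rfl⟩ := h
      rw [IsScalarTower.algebraMap_apply Z Λ A]
      exact algebraMap_mem_smul_top (Ideal.mem_map_of_mem _ hz)
    | zero => exact Submodule.zero_mem _
    | add x y _ _ hx hy => exact Submodule.add_mem _ hx hy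
    | neg x _ hx => exact Submodule.neg_mem _ hx
    | left_absorb a x _ hx => exact mul_mem_smul_top_left a hx
    | right_absorb b x _ hx => exact mul_mem_smul_top_right b hx
  · refine TwoSidedIdeal.mem_of_mem_smul_top fun z hz ↦ ?_
    induction hz using Submodule.span_induction with
    | mem z h =>
      obtain ⟨w, hw, rfl⟩ := h
      rw [← IsScalarTower.algebraMap_apply Z Λ A]
      exact TwoSidedIdeal.subset_span ⟨w, hw, rfl⟩
    | zero => rw [map_zero]; exact TwoSidedIdeal.zero_mem _
    | add x y _ _ hx hy => rw [map_add]; exact TwoSidedIdeal.add_mem _ hx hy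
    | smul r x _ hx =>
      rw [smul_eq_mul, map_mul]
      exact TwoSidedIdeal.mul_mem_left _ _ _ hx

theorem mem_of_algebraMap_mem_smul_top {ι : Type*} [Nontrivial A] (b : Module.Basis ι Λ A)
    {I : Ideal Λ} {z : Λ} (hz : algebraMap Λ A z ∈ I • (⊤ : Submodule Λ A)) : z ∈ I := by
  obtain ⟨i⟩ := b.index_nonempty
  have h : algebraMap Λ A z * b i ∈ I • Submodule.span Λ (Set.range b) := by
    rw [b.span_eq]
    exact mul_mem_smul_top_right _ hz
  obtain ⟨a, ha, hsum⟩ := (Submodule.mem_ideal_smul_span_iff_exists_sum I _ _).1 h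
  have := congr(b.repr $hsum i)
  rw [← Algebra.smul_def, ← Finsupp.linearCombination_apply, b.repr_linearCombination] at this
  have hi : a i = z := by simpa using this
  exact hi ▸ ha i

end SmulTop

section Local

variable {Λ A : Type*} [CommRing Λ] [IsLocalRing Λ] [Ring A] [Algebra Λ A] [Module.Finite Λ A]

open IsLocalRing

theorem one_notMem_maximalIdeal_smul_top [Nontrivial A] :
    (1 : A) ∉ maximalIdeal Λ • (⊤ : Submodule Λ A) := by
  intro h
  refine top_ne_bot (α := Submodule Λ A) ?_
  refine Submodule.eq_bot_of_le_smul_of_le_jacobson_bot (maximalIdeal Λ) _ Module.Finite.fg_top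
    (fun x _ ↦ ?_) (maximalIdeal_le_jacobson _)
  simpa using mul_mem_smul_top_left x h

theorem eq_zero_of_algebraMap_mem_mul_span_smul_top
    (hinj : Function.Injective (algebraMap Λ A)) {ι : Type*} [Finite ι] (c : ι → Λ)
    (hc : ∀ i, algebraMap Λ A (c i) ∈
      (maximalIdeal Λ * Ideal.span (Set.range c)) • (⊤ : Submodule Λ A)) (i : ι) : c i = 0 := by
  have hspan (z : Λ) (hz : z ∈ Ideal.span (Set.range c)) : algebraMap Λ A z ∈
      (maximalIdeal Λ * Ideal.span (Set.range c)) • (⊤ : Submodule Λ A) := by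
    induction hz using Submodule.span_induction with
    | mem z h => obtain ⟨i, rfl⟩ := h; exact hc i
    | zero => rw [map_zero]; exact Submodule.zero_mem _
    | add x y _ _ hx hy => rw [map_add]; exact Submodule.add_mem _ hx hy
    | smul r x _ hx =>
      rw [smul_eq_mul, map_mul]
      exact mul_mem_smul_top_left _ hx
  have hle : Ideal.span (Set.range c) • (⊤ : Submodule Λ A) ≤
      (maximalIdeal Λ * Ideal.span (Set.range c)) • ⊤ := by
    refine Submodule.smul_le.2 fun z hz a _ ↦ ?_
    rw [Algebra.smul_def z a]
    exact mul_mem_smul_top_right a (hspan z hz)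
  have hfg : (Ideal.span (Set.range c) • (⊤ : Submodule Λ A)).FG :=
    .smul (Submodule.fg_span (Set.finite_range c)) Module.Finite.fg_top
  have hbot := Submodule.eq_bot_of_le_smul_of_le_jacobson_bot (maximalIdeal Λ) _ hfg
    (hle.trans_eq (Submodule.mul_smul _ _ _)) (maximalIdeal_le_jacobson _)
  have := algebraMap_mem_smul_top (A := A)
    (Ideal.subset_span ⟨i, rfl⟩ : c i ∈ Ideal.span (Set.range c))
  rw [hbot, Submodule.mem_bot] at this
  exact hinj (this.trans (map_zero _).symm)

/-- A finite algebra over a local ring is free on any lifts of the matrix units of its closed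
fibre, provided the base ring acts faithfully and the closed fibre is a full matrix ring. -/
theorem exists_basis_of_surjective_matrix {K : Type*} [Field K] [Algebra Λ K]
    (hinj : Function.Injective (algebraMap Λ A)) (hK : Function.Surjective (algebraMap Λ K))
    {n : ℕ} (ψ : A →ₐ[Λ] Matrix (Fin n) (Fin n) K) (hψ : Function.Surjective ψ)
    (hker : ∀ x, ψ x = 0 → x ∈ maximalIdeal Λ • (⊤ : Submodule Λ A)) :
    Nonempty (Module.Basis (Fin n × Fin n) Λ A) := by
  choose E hE using fun p q ↦ hψ (Matrix.single p q 1)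
  let u : Fin n × Fin n → A := fun i ↦ E i.1 i.2
  have hspan : ⊤ ≤ Submodule.span Λ (Set.range u) := by
    refine Submodule.le_of_le_smul_of_le_jacobson_bot (I := maximalIdeal Λ) Module.Finite.fg_top
      (maximalIdeal_le_jacobson _) fun x _ ↦ ?_
    choose c hc using fun p q ↦ hK (ψ x p q)
    rw [← add_sub_cancel (∑ p, ∑ q, c p q • E p q) x]
    refine Submodule.add_mem_sup (Submodule.sum_mem _ fun p _ ↦ Submodule.sum_mem _ fun q _ ↦
      Submodule.smul_mem _ _ (Submodule.subset_span ⟨(p, q), rfl⟩)) (hker _ ?_)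
    rw [map_sub, sub_eq_zero]
    conv_lhs => rw [Matrix.matrix_eq_sum_single (ψ x)]
    simp [hE, Matrix.smul_single, ← hc, Algebra.algebraMap_eq_smul_one]
  have hmul (i r : Fin n × Fin n) : ∑ l, E l i.1 * u r * E i.2 l - (if r = i then 1 else 0) ∈
      maximalIdeal Λ • (⊤ : Submodule Λ A) := by
    refine hker _ ?_
    rw [map_sub, sub_eq_zero, map_sum]
    simp only [map_mul, u, hE]
    split_ifs with h
    · subst h
      simp [Matrix.single_mul_single_same, Matrix.sum_single_one]
    · rw [map_zero]
      refine Finset.sum_eq_zero fun l _ ↦ ?_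
      by_cases h1 : i.1 = r.1
      · rw [h1, Matrix.single_mul_single_same, Matrix.single_mul_single_of_ne]
        exact fun h2 ↦ h (Prod.ext h1.symm h2)
      · rw [Matrix.single_mul_single_of_ne _ _ _ _ h1, zero_mul]
  have hli : LinearIndependent Λ u := by
    rw [Fintype.linearIndependent_iff]
    intro c hc
    refine eq_zero_of_algebraMap_mem_mul_span_smul_top hinj c fun i ↦ ?_
    have h0 : ∑ r, c r • ∑ l, E l i.1 * u r * E i.2 l = 0 := by
      have : ∑ l, E l i.1 * (∑ r, c r • u r) * E i.2 l = 0 := by simp [hc]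
      rw [← this]
      simp only [Finset.smul_sum, Finset.mul_sum, Finset.sum_mul, mul_smul_comm, smul_mul_assoc]
      exact Finset.sum_comm
    have h1 : algebraMap Λ A (c i) =
        -∑ r, c r • (∑ l, E l i.1 * u r * E i.2 l - (if r = i then 1 else 0)) := by
      simp only [smul_sub, Finset.sum_sub_distrib, h0, smul_ite, smul_zero, Finset.sum_ite_eq',
        Finset.mem_univ, if_true, zero_sub, neg_neg, Algebra.algebraMap_eq_smul_one]
    rw [h1]
    refine neg_mem (sum_mem fun r _ ↦ ?_)
    rw [mul_comm, Submodule.mul_smul]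
    exact Submodule.smul_mem_smul (Ideal.subset_span ⟨r, rfl⟩) (hmul i r)
  exact ⟨.mk hli hspan⟩

/-- Over a local ring with algebraically closed residue field, every ideal is contracted from a
faithful finite algebra whose closed fibre is simple. -/
theorem mem_of_algebraMap_mem_smul_top_of_isSimple [IsAlgClosed (ResidueField Λ)]
    (hinj : Function.Injective (algebraMap Λ A))
    (hA : ∀ J : TwoSidedIdeal A, (∀ z ∈ maximalIdeal Λ, algebraMap Λ A z ∈ J) → 1 ∉ J →
      ∀ x ∈ J, x ∈ maximalIdeal Λ • (⊤ : Submodule Λ A))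
    {I : Ideal Λ} {z : Λ} (hz : algebraMap Λ A z ∈ I • (⊤ : Submodule Λ A)) : z ∈ I := by
  have : Nontrivial A := hinj.nontrivial
  let φ : A →ₐ[Λ] ResidueField Λ ⊗[Λ] A := Algebra.TensorProduct.includeRight
  have hφ : Function.Surjective φ :=
    Algebra.TensorProduct.includeRight_surjective A Ideal.Quotient.mk_surjective
  have hφker (x : A) : φ x = 0 ↔ x ∈ maximalIdeal Λ • (⊤ : Submodule Λ A) := by
    rw [← LinearMap.ker_tensorProductMk]
    rfl
  have : Nontrivial (ResidueField Λ ⊗[Λ] A) := by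
    refine ⟨φ 1, 0, ?_⟩
    rw [ne_eq, hφker]
    exact one_notMem_maximalIdeal_smul_top
  have : IsSimpleRing (ResidueField Λ ⊗[Λ] A) := by
    refine .of_eq_bot_or_eq_top fun J ↦ ?_
    rw [or_iff_not_imp_right, ← TwoSidedIdeal.one_mem_iff]
    refine fun h1 ↦ eq_bot_iff.2 fun y hy ↦ ?_
    obtain ⟨x, rfl⟩ := hφ y
    refine (hφker x).2 (hA (J.comap φ) (fun z hz ↦ ?_) ?_ x ?_)
    · rw [TwoSidedIdeal.mem_comap, (hφker _).2 (algebraMap_mem_smul_top hz)]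
      exact J.zero_mem
    · simpa [TwoSidedIdeal.mem_comap] using h1
    · exact (TwoSidedIdeal.mem_comap _).2 hy
  obtain ⟨n, _, ⟨e⟩⟩ := IsSimpleRing.exists_algEquiv_matrix_of_isAlgClosed (ResidueField Λ)
    (ResidueField Λ ⊗[Λ] A)
  obtain ⟨b⟩ := exists_basis_of_surjective_matrix hinj residue_surjective
    ((e.restrictScalars Λ).toAlgHom.comp φ) (e.surjective.comp hφ) fun x hx ↦ by
      rw [← hφker]
      exact e.injective (by simpa using hx)
  exact mem_of_algebraMap_mem_smul_top b hz

theorem exists_mul_one_add_eq_one {a : A} (ha : a ∈ maximalIdeal Λ • (⊤ : Submodule Λ A)) :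
    ∃ b : A, b * (1 + a) = 1 := by
  have : ⊤ ≤ LinearMap.range (LinearMap.mulRight Λ (1 + a)) := by
    refine Submodule.le_of_le_smul_of_le_jacobson_bot (I := maximalIdeal Λ) Module.Finite.fg_top
      (maximalIdeal_le_jacobson _) fun x _ ↦ ?_
    have hx : x = x * (1 + a) + -(x * a) := by noncomm_ring
    rw [hx]
    exact Submodule.add_mem_sup ⟨x, rfl⟩ (neg_mem (mul_mem_smul_top_left x ha))
  obtain ⟨b, hb⟩ := this (x := 1) trivial
  exact ⟨b, hb⟩

variable {Q : Type*} [Ring Q] {I : Ideal Λ} {π : A →+* Q}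

theorem map_mem_jacobson_bot (hπ : Function.Surjective π) {a : A}
    (ha : a ∈ maximalIdeal Λ • (⊤ : Submodule Λ A)) : π a ∈ (⊥ : Ideal Q).jacobson := by
  rw [Ideal.mem_jacobson_iff]
  intro y
  obtain ⟨y, rfl⟩ := hπ y
  obtain ⟨b, hb⟩ := exists_mul_one_add_eq_one (mul_mem_smul_top_left y ha)
  refine ⟨π b, ?_⟩
  rw [Ideal.mem_bot, ← map_mul, ← map_mul, ← map_add, ← map_one π, ← map_sub, ← hb]
  convert map_zero π
  noncomm_ring

theorem map_mem_jacobson_bot_iff [Nontrivial A] (hπ : Function.Surjective π)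
    (hker : ∀ x, π x = 0 → x ∈ I • (⊤ : Submodule Λ A)) (hI : I ≤ maximalIdeal Λ)
    (hA : ∀ J : TwoSidedIdeal A, (∀ z ∈ maximalIdeal Λ, algebraMap Λ A z ∈ J) → 1 ∉ J →
      ∀ x ∈ J, x ∈ maximalIdeal Λ • (⊤ : Submodule Λ A)) {a : A} :
    π a ∈ (⊥ : Ideal Q).jacobson ↔ a ∈ maximalIdeal Λ • (⊤ : Submodule Λ A) := by
  refine ⟨fun h ↦ ?_, map_mem_jacobson_bot hπ⟩
  refine hA ((⊥ : Ideal Q).jacobson.toTwoSided.comap π) (fun z hz ↦ ?_) ?_ a ?_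
  · rw [TwoSidedIdeal.mem_comap, Ideal.mem_toTwoSided]
    exact map_mem_jacobson_bot hπ (algebraMap_mem_smul_top hz)
  · rw [TwoSidedIdeal.mem_comap, Ideal.mem_toTwoSided, map_one, ← Ideal.eq_top_iff_one,
      Ideal.jacobson_eq_top_iff, Ideal.eq_top_iff_one, Ideal.mem_bot, ← map_one π]
    exact fun h ↦ one_notMem_maximalIdeal_smul_top (Submodule.smul_mono_left hI (hker _ h))
  · rwa [TwoSidedIdeal.mem_comap, Ideal.mem_toTwoSided]

theorem maximalIdeal_pow_le_iff [IsAlgClosed (ResidueField Λ)]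
    (hinj : Function.Injective (algebraMap Λ A)) (hπ : Function.Surjective π)
    (hker : ∀ x, π x = 0 ↔ x ∈ I • (⊤ : Submodule Λ A)) (hI : I ≤ maximalIdeal Λ)
    (hA : ∀ J : TwoSidedIdeal A, (∀ z ∈ maximalIdeal Λ, algebraMap Λ A z ∈ J) → 1 ∉ J →
      ∀ x ∈ J, x ∈ maximalIdeal Λ • (⊤ : Submodule Λ A)) {i : ℕ} :
    maximalIdeal Λ ^ i ≤ I ↔
      ∀ g : Fin i → Q, (∀ j, g j ∈ (⊥ : Ideal Q).jacobson) → (List.ofFn g).prod = 0 := by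
  have : Nontrivial A := hinj.nontrivial
  constructor
  · intro h g hg
    choose a ha using fun j ↦ hπ (g j)
    obtain rfl : (fun j ↦ π (a j)) = g := funext ha
    have : (List.ofFn fun j ↦ π (a j)).prod = π (List.ofFn a).prod := by
      rw [map_list_prod, List.map_ofFn]
      rfl
    rw [this, hker]
    refine Submodule.smul_mono_left h (prod_ofFn_mem_pow_smul_top a fun j ↦ ?_)
    exact (map_mem_jacobson_bot_iff hπ (fun x ↦ (hker x).1) hI hA).1 (hg j)
  · intro h
    rw [← Ideal.span_eq (maximalIdeal Λ), Ideal.span, Submodule.span_pow, Submodule.span_le]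
    intro z hz
    obtain ⟨f, rfl⟩ := Set.mem_pow.1 hz
    refine mem_of_algebraMap_mem_smul_top_of_isSimple hinj hA ?_
    rw [← hker, map_list_prod, map_list_prod, List.map_ofFn, List.map_ofFn]
    exact h _ fun j ↦ map_mem_jacobson_bot hπ (algebraMap_mem_smul_top (f j).2)

end Local

theorem isAlgClosed_residueField {k Z : Type*} [Field k] [IsAlgClosed k] [CommRing Z]
    [Algebra k Z] [Algebra.FiniteType k Z] (M : Ideal Z) [M.IsMaximal] :
    IsAlgClosed M.ResidueField := by
  have : Algebra.FiniteType k M.ResidueField :=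
    .of_surjective (IsScalarTower.toAlgHom k Z M.ResidueField) M.algebraMap_residueField_surjective
  have := finite_of_finite_type_of_isJacobsonRing k M.ResidueField
  let e : k ≃+* M.ResidueField :=
    .ofBijective (algebraMap k M.ResidueField) IsAlgClosed.algebraMap_bijective_of_isIntegral
  refine .of_exists_root _ fun p _ hp ↦ ?_
  obtain ⟨x, hx⟩ := IsAlgClosed.exists_eval₂_eq_zero_of_injective
    (e.symm : M.ResidueField →+* k) e.symm.injective p hp.degree_pos.ne'
  refine ⟨e x, e.symm.injective ?_⟩
  rw [map_zero, ← hx]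
  simpa using (Polynomial.eval₂_at_apply (e.symm : M.ResidueField →+* k) (e x)).symm

section Localization

variable {Z T : Type*} [CommRing Z] [Ring T] [Algebra Z T] (M : Ideal Z) [M.IsMaximal]

open IsLocalRing

theorem exists_sub_includeRight_mem (x : Localization.AtPrime M ⊗[Z] T) :
    ∃ t : T, x - Algebra.TensorProduct.includeRight t ∈
      maximalIdeal (Localization.AtPrime M) •
        (⊤ : Submodule (Localization.AtPrime M) (Localization.AtPrime M ⊗[Z] T)) := by
  induction x with
  | zero => exact ⟨0, by simp⟩
  | tmul s t =>
    obtain ⟨z, hz⟩ := M.algebraMap_residueField_surjective (residue _ s)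
    refine ⟨z • t, ?_⟩
    have : s ⊗ₜ[Z] t - Algebra.TensorProduct.includeRight (z • t) =
        (s - algebraMap Z (Localization.AtPrime M) z) • (1 ⊗ₜ[Z] t) := by
      simp [TensorProduct.sub_tmul, TensorProduct.smul_tmul', Algebra.algebraMap_eq_smul_one]
    rw [this]
    refine Submodule.smul_mem_smul ?_ trivial
    rw [← residue_eq_zero_iff, map_sub, ← hz, sub_eq_zero]
    rfl
  | add x y hx hy =>
    obtain ⟨s, hs⟩ := hx
    obtain ⟨t, ht⟩ := hy
    refine ⟨s + t, ?_⟩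
    rw [map_add, add_sub_add_comm]
    exact add_mem hs ht

theorem mem_maximalIdeal_smul_top_of_isCoatom
    (hM : IsCoatom (TwoSidedIdeal.span (algebraMap Z T '' (M : Set Z))))
    (J : TwoSidedIdeal (Localization.AtPrime M ⊗[Z] T))
    (hJ : ∀ z ∈ maximalIdeal (Localization.AtPrime M), algebraMap _ _ z ∈ J) (h1 : 1 ∉ J)
    (x : Localization.AtPrime M ⊗[Z] T) (hx : x ∈ J) :
    x ∈ maximalIdeal (Localization.AtPrime M) •
      (⊤ : Submodule (Localization.AtPrime M) (Localization.AtPrime M ⊗[Z] T)) := by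
  let f : T →ₐ[Z] Localization.AtPrime M ⊗[Z] T := Algebra.TensorProduct.includeRight
  have hspan {t : T} (ht : t ∈ TwoSidedIdeal.span (algebraMap Z T '' (M : Set Z))) :
      f t ∈ maximalIdeal (Localization.AtPrime M) •
        (⊤ : Submodule (Localization.AtPrime M) (Localization.AtPrime M ⊗[Z] T)) := by
    rw [TwoSidedIdeal.mem_span_algebraMap_image_iff (Λ := Z)] at ht
    rw [← Localization.AtPrime.map_eq_maximalIdeal, ← TwoSidedIdeal.mem_span_algebraMap_image_iff]
    have := TwoSidedIdeal.mem_of_mem_smul_top (I := M.map (algebraMap Z Z))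
      (J := (TwoSidedIdeal.span (algebraMap Z (Localization.AtPrime M ⊗[Z] T) '' M)).comap f)
      (fun z hz ↦ ?_) ht
    · exact (TwoSidedIdeal.mem_comap _).1 this
    · rw [TwoSidedIdeal.mem_comap, f.commutes]
      exact TwoSidedIdeal.subset_span ⟨z, by simpa using hz, rfl⟩
  have hle : TwoSidedIdeal.span (algebraMap Z T '' (M : Set Z)) ≤ J.comap f := fun t ht ↦
    (TwoSidedIdeal.mem_comap _).2 (TwoSidedIdeal.mem_of_mem_smul_top hJ (hspan ht))
  have heq := (hM.le_iff.1 hle).resolve_left fun htop ↦ h1 <| by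
    have := TwoSidedIdeal.one_mem_iff _ |>.2 htop
    simpa [TwoSidedIdeal.mem_comap] using this
  obtain ⟨t, ht⟩ := exists_sub_includeRight_mem M x
  rw [← sub_add_cancel x (f t)]
  refine add_mem ht (hspan ?_)
  rw [← heq, TwoSidedIdeal.mem_comap, ← sub_sub_cancel x (f t)]
  exact J.sub_mem hx (TwoSidedIdeal.mem_of_mem_smul_top hJ ht)

end Localization

/-- Let `T` be a prime affine `k`-algebra, finite over its affine central domain `Z`, and
`R ⊆ Z` an affine subalgebra with `Z` finite over `R`.  If `M` is a maximal ideal of `Z`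
lying in the Azumaya locus of `T` and `m = M ∩ R`, then the ramification index of `M` over
`m` (the least positive `i` with `(M Z_M)^i ⊆ m Z_M`) equals the Loewy length of the finite
dimensional algebra `T_M / m T_M` (the least positive `i` with `J(T_M/m T_M)^i = 0`);
here `T_M ≅ Z_M ⊗_Z T`. -/
theorem stmt6 {k R Z T : Type*} [Field k] [IsAlgClosed k]
    [CommRing R] [Algebra k R] [Algebra.FiniteType k R]
    [CommRing Z] [IsDomain Z] [Algebra k Z] [Algebra.FiniteType k Z]
    [Ring T] [Algebra k T] [Algebra.FiniteType k T]
    [Algebra Z T] [IsScalarTower k Z T]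
    [Algebra R Z] [IsScalarTower k R Z]
    (hprime : ∀ a b : T, (∀ x : T, a * x * b = 0) → a = 0 ∨ b = 0)
    (hinjZT : Function.Injective (algebraMap Z T))
    (hcenter : ∀ t : T, t ∈ Set.center T ↔ ∃ z : Z, algebraMap Z T z = t)
    [Module.Finite Z T]
    (hinjRZ : Function.Injective (algebraMap R Z))
    [Module.Finite R Z]
    (M : Ideal Z) [hM : M.IsMaximal]
    (hAz : IsCoatom (TwoSidedIdeal.span (algebraMap Z T '' (M : Set Z)))) :
    sInf {i : ℕ | 0 < i ∧
        (Ideal.map (algebraMap Z (Localization.AtPrime M)) M) ^ i ≤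
          Ideal.map (algebraMap Z (Localization.AtPrime M))
            (Ideal.map (algebraMap R Z) (M.comap (algebraMap R Z)))} =
      sInf {i : ℕ | 0 < i ∧
        ∀ g : Fin i →
          (TwoSidedIdeal.span ((algebraMap Z (Localization.AtPrime M ⊗[Z] T)) ''
            ((Ideal.map (algebraMap R Z) (M.comap (algebraMap R Z))) : Set Z))).ringCon.Quotient,
          (∀ j, g j ∈ (⊥ : Ideal _).jacobson) → (List.ofFn g).prod = 0} := by
  have := isAlgClosed_residueField (k := k) M
  have : IsAlgClosed (IsLocalRing.ResidueField (Localization.AtPrime M)) := this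
  have hinj : Function.Injective
      (algebraMap (Localization.AtPrime M) (Localization.AtPrime M ⊗[Z] T)) :=
    Algebra.TensorProduct.includeLeft_injective (S := Z) hinjZT
  congr! 4 with i
  rw [Localization.AtPrime.map_eq_maximalIdeal]
  refine maximalIdeal_pow_le_iff hinj (RingCon.mk'_surjective _) (fun x ↦ ?_) ?_
    (mem_maximalIdeal_smul_top_of_isCoatom M hAz)
  · rw [← TwoSidedIdeal.mem_span_algebraMap_image_iff, ← TwoSidedIdeal.mem_ker,
      TwoSidedIdeal.ker_ringCon_mk']
  · rw [← Localization.AtPrime.map_eq_maximalIdeal]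
    exact Ideal.map_mono Ideal.map_comap_le
end

section
/- Let R ⊆ Z ⊆ T with T a prime affine k-algebra finite over its center Z, Z an affine domain finite over the regular affine subalgebra R, and suppose the smooth locus of Maxspec(Z) coincides with the Azumaya locus of T. Then for a maximal ideal M of Z with m = M ∩ R, the following are equivalent: (i) M is unramified over m; (ii) M lies in the Azumaya locus of T and T/MT is a projective T/mT-module. -/
/-- The local ring `Z_M` at a maximal ideal `M` is regular. -/
def Ideal.IsRegularAt {Z : Type*} [CommRing Z] (M : Ideal Z) (hM : M.IsMaximal) : Prop :=
  letI := hM.isPrime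
  IsNoetherianRing (Localization.AtPrime M) ∧
    ringKrullDim (Localization.AtPrime M) =
      (Module.finrank (IsLocalRing.ResidueField (Localization.AtPrime M))
        (IsLocalRing.CotangentSpace (Localization.AtPrime M)) : WithBot (WithTop ℕ))

open IsLocalRing in
lemma Ideal.isRegularAt_iff_isRegularLocalRing {Z : Type*} [CommRing Z] (M : Ideal Z)
    [hM : M.IsMaximal] : M.IsRegularAt hM ↔ IsRegularLocalRing (Localization.AtPrime M) := by
  have := hM.isPrime
  constructor
  · rintro ⟨_, h⟩
    exact (IsRegularLocalRing.iff_finrank_cotangentSpace _).mpr h.symm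
  · intro h
    exact ⟨inferInstance, ((IsRegularLocalRing.iff_finrank_cotangentSpace _).mp h).symm⟩

/-- Heights do not decrease under contraction along an integral extension. -/
lemma Ideal.height_le_height_comap_of_isIntegral {P R : Type*} [CommRing P] [CommRing R]
    [Algebra P R] [Algebra.IsIntegral P R] (m : Ideal R) [m.IsPrime] :
    m.height ≤ (m.comap (algebraMap P R)).height := by
  have hmono : StrictMono (PrimeSpectrum.comap (algebraMap P R)) :=
    fun _ _ hpq ↦ Ideal.IsIntegral.comap_lt_comap hpq
  simpa [← PrimeSpectrum.height_eq_orderHeight] using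
    Order.height_le_height_apply_of_strictMono _ hmono ⟨m, ‹_›⟩

/-- In an extension of affine domains that is integral, contraction does not increase heights. -/
lemma Ideal.height_comap_le_height_of_isIntegral (k : Type*) {R Z : Type*} [Field k]
    [CommRing R] [Algebra k R] [Algebra.FiniteType k R] [CommRing Z] [IsDomain Z]
    [Algebra R Z] [FaithfulSMul R Z] [Algebra.IsIntegral R Z] [IsNoetherianRing Z]
    (M : Ideal Z) [M.IsPrime] :
    (M.comap (algebraMap R Z)).height ≤ M.height := by
  have hinj := FaithfulSMul.algebraMap_injective R Z
  have := (algebraMap R Z).domain_nontrivial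
  obtain ⟨s, g, hg, hint⟩ := exists_integral_inj_algHom_of_fg k R
  let _ : Algebra (MvPolynomial (Fin s) k) R := g.toRingHom.toAlgebra
  let _ : Algebra (MvPolynomial (Fin s) k) Z := ((algebraMap R Z).comp g.toRingHom).toAlgebra
  have : IsScalarTower (MvPolynomial (Fin s) k) R Z := .of_algebraMap_eq fun _ ↦ rfl
  have : Algebra.IsIntegral (MvPolynomial (Fin s) k) R := ⟨hint⟩
  have : Algebra.IsIntegral (MvPolynomial (Fin s) k) Z := Algebra.IsIntegral.trans R
  have : FaithfulSMul (MvPolynomial (Fin s) k) Z :=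
    (faithfulSMul_iff_algebraMap_injective _ _).mpr (hinj.comp hg)
  let p := M.comap (algebraMap (MvPolynomial (Fin s) k) Z)
  have : M.LiesOver p := ⟨rfl⟩
  calc (M.comap (algebraMap R Z)).height
      ≤ ((M.comap (algebraMap R Z)).comap (algebraMap (MvPolynomial (Fin s) k) R)).height :=
        Ideal.height_le_height_comap_of_isIntegral _
    _ = p.height := by
        rw [Ideal.comap_comap, ← IsScalarTower.algebraMap_eq]
    _ ≤ M.height := by
        rw [Ideal.height_eq_height_add_of_liesOver_of_hasGoingDown p M]
        exact le_self_add

open IsLocalRing in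
lemma Ideal.IsUnramifiedOver.isRegularLocalRing {R Z : Type*} [CommRing R] [CommRing Z]
    [Algebra R Z] [IsNoetherianRing R] [IsNoetherianRing Z] {M : Ideal Z} [hM : M.IsMaximal]
    [(M.comap (algebraMap R Z)).IsMaximal] (h : M.IsUnramifiedOver (R := R) hM)
    [IsRegularLocalRing (Localization.AtPrime (M.comap (algebraMap R Z)))]
    (hheight : (M.comap (algebraMap R Z)).height ≤ M.height) :
    IsRegularLocalRing (Localization.AtPrime M) := by
  set m := M.comap (algebraMap R Z) with hm
  refine .of_spanFinrank_maximalIdeal_le _ ?_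
  let φ := Localization.localRingHom m M (algebraMap R Z) hm
  have hmap : maximalIdeal (Localization.AtPrime M) =
      (maximalIdeal (Localization.AtPrime m)).map φ := by
    rw [← Localization.AtPrime.map_eq_maximalIdeal, ← Localization.AtPrime.map_eq_maximalIdeal,
      Ideal.map_map]
    have hcomp : φ.comp (algebraMap R (Localization.AtPrime m)) =
        (algebraMap Z (Localization.AtPrime M)).comp (algebraMap R Z) :=
      RingHom.ext fun x ↦ Localization.localRingHom_to_map m M _ hm x
    rw [hcomp, ← Ideal.map_map]
    exact h
  calc ((maximalIdeal (Localization.AtPrime M)).spanFinrank : WithBot ℕ∞)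
      ≤ (maximalIdeal (Localization.AtPrime m)).spanFinrank := by
        rw [hmap]
        exact_mod_cast Ideal.spanFinrank_map_le_of_fg φ (IsNoetherian.noetherian _)
    _ = m.height := by
        rw [IsRegularLocalRing.spanFinrank_maximalIdeal,
          IsLocalization.AtPrime.ringKrullDim_eq_height m]
    _ ≤ ringKrullDim (Localization.AtPrime M) := by
        rw [IsLocalization.AtPrime.ringKrullDim_eq_height M]
        exact_mod_cast hheight

lemma Ideal.projective_quotient_of_mul_eq_self {A : Type*} [Ring A] (J : Ideal A) (f : A)
    (hf : f ∈ J) (hJ : ∀ j ∈ J, j * f = j) : Module.Projective A (A ⧸ J) := by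
  refine .of_split (M := A) (J.liftQ (LinearMap.toSpanSingleton A A (1 - f)) fun j hj ↦ ?_)
    J.mkQ ?_
  · simp [mul_sub, hJ j hj]
  · refine Submodule.linearMap_qext _ (LinearMap.ext fun a ↦ ?_)
    have : J.mkQ (a * f) = 0 := (Submodule.Quotient.mk_eq_zero J).mpr (J.mul_mem_left a hf)
    simp only [LinearMap.comp_apply, Submodule.mkQ_apply, Submodule.liftQ_apply,
      LinearMap.toSpanSingleton_apply, smul_eq_mul, LinearMap.id_apply] at this ⊢
    rw [mul_sub, mul_one, Submodule.Quotient.mk_sub, this, sub_zero]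

lemma Ideal.exists_sub_one_mem_of_projective_quotient {A : Type*} [Ring A] (J : Ideal A)
    [Module.Projective A (A ⧸ J)] : ∃ g : A, g - 1 ∈ J ∧ ∀ j ∈ J, j * g = 0 := by
  obtain ⟨σ, hσ⟩ := Module.projective_lifting_property J.mkQ LinearMap.id J.mkQ_surjective
  refine ⟨σ (J.mkQ 1), ?_, fun j hj ↦ ?_⟩
  · rw [← Submodule.Quotient.eq]
    exact LinearMap.congr_fun hσ (J.mkQ 1)
  · rw [← smul_eq_mul, ← map_smul, ← map_smul, smul_eq_mul, mul_one, Submodule.mkQ_apply,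
      (Submodule.Quotient.mk_eq_zero J).mpr hj, map_zero]

/-- If `M S = J S` in the local ring `S` at the maximal ideal `M`, then `M` is generated
modulo `J` by a single element acting as the identity on `M / J`. -/
lemma Ideal.exists_mem_forall_mul_sub_mem_of_map_atPrime_eq {Z : Type*} [CommRing Z]
    [IsNoetherianRing Z] (M J : Ideal Z) [hM : M.IsMaximal]
    (h : M.map (algebraMap Z (Localization.AtPrime M)) =
      J.map (algebraMap Z (Localization.AtPrime M))) :
    ∃ y ∈ M, ∀ z ∈ M, z * y - z ∈ J := by
  obtain ⟨s, hs, hsM⟩ : ∃ s ∉ M, ∀ z ∈ M, s * z ∈ J := by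
    have hle : M.map (algebraMap Z (Localization.AtPrime M)) ≤
      J.map (algebraMap Z (Localization.AtPrime M)) := h.le
    rw [Ideal.map_le_iff_le_comap] at hle
    obtain ⟨t, ht⟩ := IsNoetherian.noetherian M
    have hloc : ∀ z ∈ M, ∃ s ∉ M, s * z ∈ J := fun z hz ↦ by
      have := hle hz
      rw [Ideal.mem_comap, IsLocalization.algebraMap_mem_map_algebraMap_iff M.primeCompl] at this
      obtain ⟨s, hs, hsz⟩ := this
      exact ⟨s, hs, hsz⟩
    choose! c hc hcJ using hloc
    have htM : ∀ z ∈ t, z ∈ M := fun z hz ↦ ht ▸ Submodule.subset_span hz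
    refine ⟨∏ z ∈ t, c z, ?_, fun z hz ↦ ?_⟩
    · rw [hM.isPrime.prod_mem_iff]
      rintro ⟨z, hz, hcz⟩
      exact hc z (htM z hz) hcz
    · rw [← ht] at hz
      induction hz using Submodule.span_induction with
      | mem z hz =>
        obtain ⟨b, hb⟩ := Finset.dvd_prod_of_mem c hz
        rw [hb, mul_right_comm]
        exact J.mul_mem_right _ (hcJ z (htM z hz))
      | zero => simp
      | add x y _ _ hx hy => rw [mul_add]; exact J.add_mem hx hy
      | smul a x _ hx => rw [smul_eq_mul, mul_left_comm]; exact J.mul_mem_left _ hx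
  obtain ⟨u, y, hy, huy⟩ := hM.exists_inv hs
  refine ⟨y, hy, fun z hz ↦ ?_⟩
  have : z * y - z = -(u * (s * z)) := by linear_combination z * huy
  rw [this]
  exact J.neg_mem (J.mul_mem_left _ (hsM z hz))

open IsLocalRing in
/-- An ideal `I` of a regular local ring such that `𝔪 A = I A` for some faithful finite module `A`
is the maximal ideal. -/
lemma IsRegularLocalRing.eq_maximalIdeal_of_smul_top_le {S A : Type*} [CommRing S]
    [IsRegularLocalRing S] [AddCommGroup A] [Module S A] [Module.Finite S A] [FaithfulSMul S A]
    (I : Ideal S) (hI : I ≤ maximalIdeal S)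
    (h : maximalIdeal S • (⊤ : Submodule S A) ≤
      I • ⊤ ⊔ maximalIdeal S • maximalIdeal S • (⊤ : Submodule S A)) :
    I = maximalIdeal S := by
  classical
  set 𝔪 := maximalIdeal S with h𝔪
  let I' : Set 𝔪 := {x | (x : S) ∈ I}
  obtain ⟨b, hb, hspan, hlin⟩ :=
    exists_linearIndependent (ResidueField S) (𝔪.toCotangent '' I')
  have hbfin : b.Finite := hlin.setFinite
  obtain ⟨B, hBI, hBinj, rfl⟩ :=
    Set.SurjOn.exists_subset_injOn_image_eq (f := 𝔪.toCotangent) (s := I') (t := b) hb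
  have hBfin : B.Finite := hbfin.of_finite_image hBinj
  let L : Ideal S := Ideal.span (Subtype.val '' B)
  have hLI : L ≤ I := Ideal.span_le.mpr (by rintro _ ⟨x, hx, rfl⟩; exact hBI hx)
  have hIL : I ≤ L ⊔ 𝔪 ^ 2 := by
    intro x hx
    have hxspan : 𝔪.toCotangent ⟨x, hI hx⟩ ∈
        Submodule.span (ResidueField S) (𝔪.toCotangent '' B) :=
      hspan ▸ Submodule.subset_span ⟨⟨x, hI hx⟩, hx, rfl⟩
    rw [← Submodule.restrictScalars_mem S, Submodule.restrictScalars_span _ _ residue_surjective,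
      ← Submodule.map_span] at hxspan
    obtain ⟨y, hy, hxy⟩ := hxspan
    have hyL : (y : S) ∈ L := by
      have := Submodule.mem_map_of_mem (f := 𝔪.subtype) hy
      rwa [Submodule.map_span] at this
    have hsub := (𝔪.toCotangent_eq).mp hxy.symm
    have : x = y + (x - y) := by ring
    rw [this]
    exact Submodule.add_mem_sup hyL hsub
  have hnak : 𝔪 • (⊤ : Submodule S A) ≤ L • ⊤ := by
    refine Submodule.le_of_le_smul_of_le_jacobson_bot (I := 𝔪) (IsNoetherian.noetherian _)
      (IsLocalRing.jacobson_eq_maximalIdeal _ bot_ne_top).ge (h.trans ?_)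
    refine sup_le ((Submodule.smul_mono_left hIL).trans ?_) le_sup_right
    rw [Submodule.sup_smul, pow_two, Submodule.mul_smul]
  have hrad : 𝔪 ∈ L.minimalPrimes := by
    refine ⟨⟨inferInstance, hLI.trans hI⟩, fun P ⟨hP, hLP⟩ _ x hx ↦ ?_⟩
    have hrange : LinearMap.range (algebraMap S (Module.End S A) x) ≤ L • ⊤ := by
      rintro _ ⟨a, rfl⟩
      exact hnak (Submodule.smul_mem_smul hx trivial)
    obtain ⟨p, hp, -, hcoeff, hzero⟩ :=
      LinearMap.exists_monic_and_natDegree_eq_and_coeff_mem_pow_and_aeval_eq_zero S _ L hrange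
    have hpx : p.eval x = 0 := by
      rw [Polynomial.aeval_algebraMap_apply, Polynomial.coe_aeval_eq_eval] at hzero
      refine FaithfulSMul.eq_of_smul_eq_smul (α := A) fun a ↦ ?_
      simpa using LinearMap.congr_fun hzero a
    rw [hp.as_sum, Polynomial.eval_add, Polynomial.eval_finsetSum] at hpx
    simp only [Polynomial.eval_pow, Polynomial.eval_X, Polynomial.eval_mul,
      Polynomial.eval_C] at hpx
    refine hP.mem_of_pow_mem p.natDegree ?_
    rw [eq_neg_of_add_eq_zero_left hpx]
    refine P.neg_mem (P.sum_mem fun i hi ↦ P.mul_mem_right _ (hLP ?_))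
    exact Ideal.pow_le_self (Nat.sub_ne_zero_of_lt (Finset.mem_range.mp hi)) (hcoeff i)
  have hcard : Module.finrank (ResidueField S) (CotangentSpace S) ≤
      (𝔪.toCotangent '' B).ncard := by
    have hht := Ideal.height_le_card_of_mem_minimalPrimes_span (hBfin.image _) hrad
    have hdim := (IsRegularLocalRing.iff_finrank_cotangentSpace S).mp ‹_›
    rw [← maximalIdeal_height_eq_ringKrullDim] at hdim
    have hdim' : (Module.finrank (ResidueField S) (CotangentSpace S) : ℕ∞) = 𝔪.height := by
      exact_mod_cast hdim
    rw [← hdim', Nat.cast_le, Set.ncard_image_of_injective _ Subtype.val_injective] at hht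
    rwa [hBinj.ncard_image]
  have htop : Submodule.span (ResidueField S) (𝔪.toCotangent '' B) = ⊤ := by
    refine Submodule.eq_top_of_finrank_eq (le_antisymm (Submodule.finrank_le _) ?_)
    have := hbfin.fintype
    rw [finrank_span_set_eq_card hlin, ← Set.ncard_eq_toFinset_card']
    exact hcard
  have hBtop := CotangentSpace.span_image_eq_top_iff.mp htop
  refine le_antisymm hI fun x hx ↦ hLI ?_
  have := Submodule.mem_map_of_mem (f := 𝔪.subtype)
    (show (⟨x, hx⟩ : 𝔪) ∈ Submodule.span S B from hBtop ▸ trivial)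
  rwa [Submodule.map_span] at this

lemma TwoSidedIdeal.mem_smul_top_of_mem_span_image {Z T : Type*} [CommRing Z] [Ring T]
    [Algebra Z T] (J : Ideal Z) {x : T}
    (hx : x ∈ TwoSidedIdeal.span (algebraMap Z T '' (J : Set Z))) :
    x ∈ J • (⊤ : Submodule Z T) := by
  let I : TwoSidedIdeal T := .mk' (J • (⊤ : Submodule Z T) : Submodule Z T)
    (Submodule.zero_mem _) (fun hx hy ↦ Submodule.add_mem _ hx hy) (fun hx ↦ Submodule.neg_mem _ hx)
    (fun {x y} hy ↦ by
      refine Submodule.smul_induction_on hy (fun r hr t _ ↦ ?_) fun a b ha hb ↦ ?_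
      · rw [SetLike.mem_coe, mul_smul_comm]
        exact Submodule.smul_mem_smul hr trivial
      · rw [mul_add]
        exact Submodule.add_mem _ ha hb)
    (fun {x y} hx ↦ by
      refine Submodule.smul_induction_on hx (fun r hr t _ ↦ ?_) fun a b ha hb ↦ ?_
      · rw [SetLike.mem_coe, smul_mul_assoc]
        exact Submodule.smul_mem_smul hr trivial
      · rw [add_mul]
        exact Submodule.add_mem _ ha hb)
  suffices TwoSidedIdeal.span (algebraMap Z T '' (J : Set Z)) ≤ I from
    (TwoSidedIdeal.mem_mk' ..).mp (this hx)
  rw [TwoSidedIdeal.span_le]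
  rintro _ ⟨z, hz, rfl⟩
  refine (TwoSidedIdeal.mem_mk' ..).mpr ?_
  rw [Algebra.algebraMap_eq_smul_one]
  exact Submodule.smul_mem_smul hz trivial

lemma Ideal.map_algebraMap_le_smul_top {Z T : Type*} [CommRing Z] [Ring T] [Algebra Z T]
    (J : Ideal Z) : (J.map (algebraMap Z T)).restrictScalars Z ≤ J • (⊤ : Submodule Z T) := by
  intro x hx
  rw [Submodule.restrictScalars_mem, Ideal.map] at hx
  induction hx using Submodule.span_induction with
  | mem x hx =>
    obtain ⟨z, hz, rfl⟩ := hx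
    rw [Algebra.algebraMap_eq_smul_one]
    exact Submodule.smul_mem_smul hz trivial
  | zero => exact zero_mem _
  | add x y _ _ hx hy => exact add_mem hx hy
  | smul a x _ hx =>
    refine Submodule.smul_induction_on hx (fun r hr t _ ↦ ?_) fun a b ha hb ↦ ?_
    · rw [smul_comm]
      exact Submodule.smul_mem_smul hr trivial
    · rw [smul_add]
      exact add_mem ha hb

open scoped TensorProduct in
/-- Base change to the local ring at `M` of `IsRegularLocalRing.eq_maximalIdeal_of_smul_top_le`. -/
lemma Ideal.map_atPrime_eq_of_smul_top_le {Z T : Type*} [CommRing Z] [Ring T] [Algebra Z T]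
    [Module.Finite Z T] (hinj : Function.Injective (algebraMap Z T))
    (M J : Ideal Z) [hM : M.IsMaximal] [IsRegularLocalRing (Localization.AtPrime M)] (hJM : J ≤ M)
    (h : M • (⊤ : Submodule Z T) ≤ J • ⊤ ⊔ M • M • (⊤ : Submodule Z T)) :
    M.map (algebraMap Z (Localization.AtPrime M)) =
      J.map (algebraMap Z (Localization.AtPrime M)) := by
  let S := Localization.AtPrime M
  let f : T →ₗ[Z] TensorProduct Z S T := TensorProduct.mk Z S T 1
  have hmapM : M.map (algebraMap Z S) = IsLocalRing.maximalIdeal S :=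
    Localization.AtPrime.map_eq_maximalIdeal
  have hfaith : FaithfulSMul S (TensorProduct Z S T) := by
    have hlT : Function.Injective ((Algebra.linearMap Z T).lTensor S) :=
      Module.Flat.lTensor_preserves_injective_linearMap _ hinj
    refine ⟨fun {a b} hab ↦ ?_⟩
    have h1 := hab (1 ⊗ₜ[Z] (1 : T))
    rw [TensorProduct.smul_tmul', TensorProduct.smul_tmul'] at h1
    have h2 : a ⊗ₜ[Z] (1 : Z) = b ⊗ₜ[Z] (1 : Z) := hlT (by simpa using h1)
    simpa using congr(TensorProduct.rid Z S $h2)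
  have hf (I : Ideal Z) (N : Submodule Z T) (N' : Submodule S (TensorProduct Z S T))
      (hN : ∀ t ∈ N, f t ∈ N') {x : T} (hx : x ∈ I • N) :
      f x ∈ I.map (algebraMap Z S) • N' := by
    refine Submodule.smul_induction_on hx (fun r hr t ht ↦ ?_) fun a b ha hb ↦ ?_
    · rw [map_smul, ← algebraMap_smul S]
      exact Submodule.smul_mem_smul (Ideal.mem_map_of_mem _ hr) (hN t ht)
    · rw [map_add]
      exact add_mem ha hb
  rw [hmapM]
  refine (IsRegularLocalRing.eq_maximalIdeal_of_smul_top_le (A := TensorProduct Z S T) _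
    (hmapM ▸ Ideal.map_mono hJM) ?_).symm
  rw [← hmapM]
  refine Submodule.smul_le.mpr fun r hr x _ ↦ ?_
  revert x
  refine Submodule.span_induction (p := fun r _ ↦ ∀ x ∈ (⊤ : Submodule S (S ⊗[Z] T)), r • x ∈
    J.map (algebraMap Z S) • ⊤ ⊔ M.map (algebraMap Z S) • M.map (algebraMap Z S) •
      (⊤ : Submodule S (S ⊗[Z] T))) ?_ ?_ ?_ ?_ hr
  rotate_left
  · intro x _
    rw [zero_smul]
    exact zero_mem _
  · intro a b _ _ ha hb x hx
    rw [add_smul]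
    exact add_mem (ha x hx) (hb x hx)
  · intro a b _ hb x hx
    rw [smul_assoc]
    exact Submodule.smul_mem _ _ (hb x hx)
  rintro _ ⟨z, hz, rfl⟩ x -
  induction x using TensorProduct.induction_on with
  | zero => rw [smul_zero]; exact zero_mem _
  | add a b ha hb => rw [smul_add]; exact add_mem ha hb
  | tmul s t =>
    have hst : algebraMap Z S z • (s ⊗ₜ[Z] t) = s • f (z • t) := by
      simp [f, TensorProduct.smul_tmul']
    rw [hst]
    refine Submodule.smul_mem _ _ ?_
    obtain ⟨u, hu, v, hv, huv⟩ := Submodule.mem_sup.mp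
      (h (Submodule.smul_mem_smul hz (trivial : t ∈ (⊤ : Submodule Z T))))
    rw [← huv, map_add]
    exact Submodule.add_mem_sup (hf J ⊤ ⊤ (fun _ _ ↦ trivial) hu)
      (hf M _ _ (fun x hx ↦ hf M ⊤ ⊤ (fun _ _ ↦ trivial) hx) hv)

section QuotientOfSpan

variable {Z T : Type*} [CommRing Z] [Ring T] [Algebra Z T]

lemma TwoSidedIdeal.mk'_ringCon_eq_zero_iff (I : TwoSidedIdeal T) (t : T) :
    RingCon.mk' I.ringCon t = 0 ↔ t ∈ I := by
  rw [TwoSidedIdeal.mem_iff, ← RingCon.eq]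
  rfl

lemma Ideal.projective_quotient_map_mk'_of_mem (M J : Ideal Z) {y : Z} (hy : y ∈ M)
    (hyM : ∀ z ∈ M, z * y - z ∈ J) :
    Module.Projective (TwoSidedIdeal.span (algebraMap Z T '' (J : Set Z))).ringCon.Quotient
      (_ ⧸ ((M.map (algebraMap Z T)).map
        (RingCon.mk' (TwoSidedIdeal.span (algebraMap Z T '' (J : Set Z))).ringCon))) := by
  set π := RingCon.mk' (TwoSidedIdeal.span (algebraMap Z T '' (J : Set Z))).ringCon with hπ
  refine Ideal.projective_quotient_of_mul_eq_self _ (π (algebraMap Z T y))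
    (Ideal.mem_map_of_mem _ (Ideal.mem_map_of_mem _ hy)) fun j hj ↦ ?_
  rw [Ideal.map_map, Ideal.map] at hj
  induction hj using Submodule.span_induction with
  | mem x hx =>
    obtain ⟨z, hz, rfl⟩ := hx
    rw [RingHom.comp_apply, ← map_mul, ← map_mul, ← sub_eq_zero, ← map_sub, ← map_sub, hπ,
      TwoSidedIdeal.mk'_ringCon_eq_zero_iff]
    exact TwoSidedIdeal.subset_span ⟨_, hyM z hz, rfl⟩
  | zero => rw [zero_mul]
  | add a b _ _ ha hb => rw [add_mul, ha, hb]
  | smul a x _ hx => rw [smul_eq_mul, mul_assoc, hx]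

lemma Ideal.smul_top_le_of_projective_quotient_map_mk' (M J : Ideal Z) (hJM : J ≤ M)
    [Module.Projective (TwoSidedIdeal.span (algebraMap Z T '' (J : Set Z))).ringCon.Quotient
      (_ ⧸ ((M.map (algebraMap Z T)).map
        (RingCon.mk' (TwoSidedIdeal.span (algebraMap Z T '' (J : Set Z))).ringCon)))] :
    M • (⊤ : Submodule Z T) ≤ J • ⊤ ⊔ M • M • (⊤ : Submodule Z T) := by
  set π := RingCon.mk' (TwoSidedIdeal.span (algebraMap Z T '' (J : Set Z))).ringCon with hπ
  have hsurj : Function.Surjective π := RingCon.mk'_surjective _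
  have hker {t : T} (ht : π t = 0) : t ∈ J • (⊤ : Submodule Z T) :=
    TwoSidedIdeal.mem_smul_top_of_mem_span_image J
      ((TwoSidedIdeal.mk'_ringCon_eq_zero_iff _ _).mp ht)
  obtain ⟨g', hg, hMg⟩ :=
    Ideal.exists_sub_one_mem_of_projective_quotient ((M.map (algebraMap Z T)).map π)
  obtain ⟨g, rfl⟩ := hsurj g'
  have hg1 : g - 1 ∈ M • (⊤ : Submodule Z T) := by
    obtain ⟨x, hx, hxg⟩ := (Ideal.mem_map_iff_of_surjective π hsurj).mp hg
    have : g - 1 = x + (g - 1 - x) := by abel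
    rw [this]
    refine add_mem (Ideal.map_algebraMap_le_smul_top M hx)
      (Submodule.smul_mono_left hJM (hker ?_))
    rw [map_sub, map_sub, map_one, hxg, sub_self]
  refine Submodule.smul_le.mpr fun z hz t _ ↦ ?_
  have hzt : z • t = (z • g) * t + z • (-((g - 1) * t)) := by
    rw [smul_mul_assoc, ← smul_add]
    congr 1
    noncomm_ring
  have hmul {I : Ideal Z} {x : T} (hx : x ∈ I • (⊤ : Submodule Z T)) :
      x * t ∈ I • (⊤ : Submodule Z T) := by
    refine Submodule.smul_induction_on hx (fun r hr a _ ↦ ?_) fun a b ha hb ↦ ?_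
    · rw [smul_mul_assoc]
      exact Submodule.smul_mem_smul hr trivial
    · rw [add_mul]
      exact add_mem ha hb
  rw [hzt]
  refine Submodule.add_mem_sup (hmul (hker ?_)) (Submodule.smul_mem_smul hz (neg_mem (hmul hg1)))
  rw [Algebra.smul_def, map_mul]
  exact hMg _ (Ideal.mem_map_of_mem _ (Ideal.mem_map_of_mem _ hz))

end QuotientOfSpan

/-- Let `R ⊆ Z ⊆ T` with `T` a prime affine `k`-algebra finite over its center `Z` (an affine
domain), `Z` finite over the regular affine subalgebra `R`, and suppose the smooth locus of
`Maxspec Z` coincides with the Azumaya locus of `T`.  Then for a maximal ideal `M` of `Z` with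
`m = M ∩ R` the following are equivalent: (i) `M` is unramified over `m`; (ii) `M` lies in the
Azumaya locus of `T` and `T/MT` is a projective `T/mT`-module. -/
theorem stmt7 {k R Z T : Type*} [Field k] [IsAlgClosed k]
    [CommRing R] [Algebra k R] [Algebra.FiniteType k R]
    [CommRing Z] [IsDomain Z] [Algebra k Z] [Algebra.FiniteType k Z]
    [Ring T] [Algebra k T] [Algebra.FiniteType k T]
    [Algebra Z T] [IsScalarTower k Z T]
    [Algebra R Z] [IsScalarTower k R Z]
    (hprime : ∀ a b : T, (∀ x : T, a * x * b = 0) → a = 0 ∨ b = 0)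
    (hinjZT : Function.Injective (algebraMap Z T))
    (hcenter : ∀ t : T, t ∈ Set.center T ↔ ∃ z : Z, algebraMap Z T z = t)
    [Module.Finite Z T]
    (hinjRZ : Function.Injective (algebraMap R Z))
    [Module.Finite R Z]
    (hregR : ∀ (m : Ideal R) (hm : m.IsMaximal), m.IsRegularAt hm)
    (hsmoothAz : ∀ (N : Ideal Z) (hN : N.IsMaximal),
      N.IsRegularAt hN ↔ IsCoatom (TwoSidedIdeal.span (algebraMap Z T '' (N : Set Z))))
    (M : Ideal Z) (hM : M.IsMaximal) :
    M.IsUnramifiedOver (R := R) hM ↔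
      (IsCoatom (TwoSidedIdeal.span (algebraMap Z T '' (M : Set Z))) ∧
        Module.Projective
          ((TwoSidedIdeal.span (algebraMap Z T ''
            ((Ideal.map (algebraMap R Z) (M.comap (algebraMap R Z))) : Set Z))).ringCon.Quotient)
          (_ ⧸ (Ideal.map
            (RingCon.mk' (TwoSidedIdeal.span (algebraMap Z T ''
              ((Ideal.map (algebraMap R Z) (M.comap (algebraMap R Z))) : Set Z))).ringCon)
            (Ideal.map (algebraMap Z T) M)))) := by
  have : IsNoetherianRing R := Algebra.FiniteType.isNoetherianRing k R
  have : IsNoetherianRing Z := Algebra.FiniteType.isNoetherianRing k Z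
  have : FaithfulSMul R Z := (faithfulSMul_iff_algebraMap_injective R Z).mpr hinjRZ
  have hm : (M.comap (algebraMap R Z)).IsMaximal :=
    Ideal.isMaximal_comap_of_isIntegral_of_isMaximal M
  constructor
  · intro h
    have := (Ideal.isRegularAt_iff_isRegularLocalRing _).mp (hregR _ hm)
    have := h.isRegularLocalRing (Ideal.height_comap_le_height_of_isIntegral k M)
    refine ⟨(hsmoothAz M hM).mp ((Ideal.isRegularAt_iff_isRegularLocalRing M).mpr this), ?_⟩
    obtain ⟨y, hy, hyM⟩ := Ideal.exists_mem_forall_mul_sub_mem_of_map_atPrime_eq M _ h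
    exact Ideal.projective_quotient_map_mk'_of_mem M _ hy hyM
  · rintro ⟨hAz, hproj⟩
    have := (Ideal.isRegularAt_iff_isRegularLocalRing M).mp ((hsmoothAz M hM).mpr hAz)
    have hle : (M.comap (algebraMap R Z)).map (algebraMap R Z) ≤ M := Ideal.map_comap_le
    exact Ideal.map_atPrime_eq_of_smul_top_le hinjZT M _ hle
      (Ideal.smul_top_le_of_projective_quotient_map_mk' M _ hle)
end
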